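/- If Q(G) is Archimedean and the Slater condition holds for the LSIPP problem (P), then the sequence of truncated sum-of-squares relaxation values p^sos_k = inf{ c^T x : x ∈ ℝ^m, a(Y)^T x + b(Y) ∈ Q_k(G) }, for k ≥ d_P, is nonincreasing in k, satisfies p^sos_k ≥ p* for every k, and converges to p* as k → ∞. -/

import Mathlib

open MvPolynomial

/-- A polynomial is a sum of squares. -/
def SOSPoly {n : ℕ} (p : MvPolynomial (Fin n) ℝ) : Prop :=
  ∃ (t : ℕ) (q : Fin t → MvPolynomial (Fin n) ℝ), p = ∑ i, q i ^ 2

/-- Membership in the quadratic module Q(G) generated by `g`. -/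
def QModMem {n s : ℕ} (g : Fin s → MvPolynomial (Fin n) ℝ)
    (p : MvPolynomial (Fin n) ℝ) : Prop :=
  ∃ (σ₀ : MvPolynomial (Fin n) ℝ) (σ : Fin s → MvPolynomial (Fin n) ℝ),
    SOSPoly σ₀ ∧ (∀ j, SOSPoly (σ j)) ∧ p = σ₀ + ∑ j, σ j * g j

/-- The basic semialgebraic index set S. -/
def indexSet {n s : ℕ} (g : Fin s → MvPolynomial (Fin n) ℝ) : Set (Fin n → ℝ) :=
  {y | ∀ j, 0 ≤ eval y (g j)}

/-- Feasibility for the LSIPP problem (P): a(y)ᵀx + b(y) ≥ 0 for all y ∈ S. -/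
def isFeasible {n m s : ℕ} (a : Fin m → MvPolynomial (Fin n) ℝ)
    (b : MvPolynomial (Fin n) ℝ) (g : Fin s → MvPolynomial (Fin n) ℝ)
    (x : Fin m → ℝ) : Prop :=
  ∀ y ∈ indexSet g, 0 ≤ (∑ i, x i * eval y (a i)) + eval y b

/-- The quadratic module Q(G) is Archimedean. -/
def QMArchimedean {n s : ℕ} (g : Fin s → MvPolynomial (Fin n) ℝ) : Prop :=
  ∃ ψ : MvPolynomial (Fin n) ℝ, QModMem g ψ ∧
    IsCompact {y : Fin n → ℝ | 0 ≤ eval y ψ}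

/-- Membership in the k-th truncated quadratic module Q_k(G). -/
def QModMemK {n s : ℕ} (g : Fin s → MvPolynomial (Fin n) ℝ) (k : ℕ)
    (p : MvPolynomial (Fin n) ℝ) : Prop :=
  ∃ (σ₀ : MvPolynomial (Fin n) ℝ) (σ : Fin s → MvPolynomial (Fin n) ℝ),
    SOSPoly σ₀ ∧ (∀ j, SOSPoly (σ j)) ∧ σ₀.totalDegree ≤ 2 * k ∧
    (∀ j, (σ j * g j).totalDegree ≤ 2 * k) ∧ p = σ₀ + ∑ j, σ j * g j

/-- ⌈d/2⌉ for natural d. -/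
def halfCeil (d : ℕ) : ℕ := (d + 1) / 2

/-- d_S = max{1, d_1, …, d_s}. -/
def dS {n s : ℕ} (g : Fin s → MvPolynomial (Fin n) ℝ) : ℕ :=
  max 1 (Finset.univ.sup fun j => halfCeil (g j).totalDegree)

/-- d_P = max{d_S, ⌈deg a_i / 2⌉, ⌈deg b / 2⌉}. -/
def dP {n m s : ℕ} (a : Fin m → MvPolynomial (Fin n) ℝ)
    (b : MvPolynomial (Fin n) ℝ) (g : Fin s → MvPolynomial (Fin n) ℝ) : ℕ :=
  max (max (dS g) (Finset.univ.sup fun i => halfCeil (a i).totalDegree))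
    (halfCeil b.totalDegree)

/-- The k-th SOS relaxation value p^sos_k (as an extended real, +∞ if infeasible). -/
noncomputable def psosK {n m s : ℕ} (c : Fin m → ℝ) (a : Fin m → MvPolynomial (Fin n) ℝ)
    (b : MvPolynomial (Fin n) ℝ) (g : Fin s → MvPolynomial (Fin n) ℝ) (k : ℕ) : EReal :=
  sInf ((fun x : Fin m → ℝ => ((∑ i, c i * x i : ℝ) : EReal)) ''
    {x | QModMemK g k ((∑ i, C (x i) * a i) + b)})

namespace Polynomial

open SignType

/-- The intermediate value property for polynomials over an ordered field. -/
def PolyIVT (L : Type*) [Field L] [LinearOrder L] : Prop :=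
  ∀ (p : L[X]) (a b : L), a < b → p.eval a * p.eval b < 0 → ∃ c, a < c ∧ c < b ∧ p.eval c = 0

variable {L L' : Type*} [Field L] [LinearOrder L] [IsStrictOrderedRing L]
  [Field L'] [LinearOrder L'] [IsStrictOrderedRing L']

theorem PolyIVT.rolle (hL : PolyIVT L) (f : L[X]) {a b : L} (hab : a < b)
    (ha : f.eval a = 0) (hb : f.eval b = 0) :
    ∃ c, a < c ∧ c < b ∧ f.derivative.eval c = 0 := by
  classical
  by_cases hf : f = 0
  · obtain ⟨c, h1, h2⟩ := exists_between hab
    exact ⟨c, h1, h2, by simp [hf]⟩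
  -- replace `b` by the smallest root above `a`
  set s := f.roots.toFinset.filter (a < ·) with hs
  have hmem : ∀ x, x ∈ s ↔ f.eval x = 0 ∧ a < x := by
    intro x; simp [hs, hf]
  have hbs : b ∈ s := (hmem b).2 ⟨hb, hab⟩
  set b' := s.min' ⟨b, hbs⟩
  have hb's : b' ∈ s := s.min'_mem _
  have hb'b : b' ≤ b := s.min'_le _ hbs
  obtain ⟨hb'0, hab'⟩ := (hmem b').1 hb's
  have hno : ∀ x, a < x → x < b' → f.eval x ≠ 0 := fun x h1 h2 h3 =>
    absurd (s.min'_le x ((hmem x).2 ⟨h3, h1⟩)) (not_le.2 h2)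
  obtain ⟨g₁, hg₁, hg₁a⟩ := exists_eq_pow_rootMultiplicity_mul_and_not_dvd f hf a
  set m := f.rootMultiplicity a
  have hm : 0 < m := (rootMultiplicity_pos hf).2 ha
  have hg₁0 : g₁ ≠ 0 := by rintro rfl; simp at hg₁a
  obtain ⟨g, hg, hgb⟩ := exists_eq_pow_rootMultiplicity_mul_and_not_dvd g₁ hg₁0 b'
  set k := g₁.rootMultiplicity b'
  have hk : 0 < k := by
    refine (rootMultiplicity_pos hg₁0).2 ?_
    have : f.eval b' = (b' - a) ^ m * g₁.eval b' := by
      conv_lhs => rw [hg₁]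
      simp
    rw [this] at hb'0
    exact (mul_eq_zero.1 hb'0).resolve_left (pow_ne_zero _ (sub_ne_zero.2 hab'.ne'))
  rw [dvd_iff_isRoot, IsRoot.def] at hg₁a hgb
  have hga : g.eval a ≠ 0 := by
    intro h; apply hg₁a; rw [hg]; simp [h]
  have hgab : 0 < g.eval a * g.eval b' := by
    rcases lt_trichotomy (g.eval a * g.eval b') 0 with h | h | h
    · obtain ⟨c, h1, h2, h3⟩ := hL g a b' hab' h
      exact absurd (by rw [hg₁, hg]; simp [h3]) (hno c h1 h2)
    · exact absurd h (mul_ne_zero hga hgb)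
    · exact h
  obtain ⟨m', hm'⟩ : ∃ m', m = m' + 1 := ⟨m - 1, by omega⟩
  obtain ⟨k', hk'⟩ : ∃ k', k = k' + 1 := ⟨k - 1, by omega⟩
  set h : L[X] := C (m : L) * (X - C b') * g + C (k : L) * (X - C a) * g
    + (X - C a) * (X - C b') * derivative g with hh
  have hder : derivative f = (X - C a) ^ m' * (X - C b') ^ k' * h := by
    rw [hg₁, hg, hh, hm', hk']
    simp only [derivative_mul, derivative_X_sub_C_pow]
    simp
    ring
  have hsign : h.eval a * h.eval b' < 0 := by
    have e : h.eval a * h.eval b' =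
        -((m : L) * k * (b' - a) ^ 2 * (g.eval a * g.eval b')) := by
      simp [hh]; ring
    rw [e, neg_lt_zero]
    have := sub_pos.2 hab'
    positivity
  obtain ⟨c, h1, h2, h3⟩ := hL h a b' hab' hsign
  exact ⟨c, h1, h2.trans_le hb'b, by rw [hder]; simp [h3]⟩

theorem PolyIVT.exists_deriv_eq_slope (hL : PolyIVT L) (f : L[X]) {a b : L} (hab : a < b) :
    ∃ c, a < c ∧ c < b ∧ f.eval b - f.eval a = f.derivative.eval c * (b - a) := by
  obtain ⟨c, h1, h2, h3⟩ := hL.rolle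
    (C (b - a) * (f - C (f.eval a)) - C (f.eval b - f.eval a) * (X - C a)) hab
    (by simp) (by simp [mul_comm])
  refine ⟨c, h1, h2, ?_⟩
  simp at h3
  linear_combination -h3

/-- If every root of `p` lies on the same side of `x` and `y`, then `p` has the same sign at
both points. -/
theorem PolyIVT.sign_eq (hL : PolyIVT L) (p : L[X]) {x y : L}
    (h : ∀ w, p.eval w = 0 → cmp w x = cmp w y) : sign (p.eval x) = sign (p.eval y) := by
  have key : ∀ x y : L, x < y → (∀ w, p.eval w = 0 → cmp w x = cmp w y) →
      0 < p.eval x * p.eval y := by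
    intro x y hxy h
    rcases lt_trichotomy (p.eval x * p.eval y) 0 with h0 | h0 | h0
    · obtain ⟨c, h1, h2, h3⟩ := hL p x y hxy h0
      have := h c h3
      rw [(cmp_eq_gt_iff c x).2 h1, (cmp_eq_lt_iff c y).2 h2] at this
      cases this
    · rcases mul_eq_zero.1 h0 with h0 | h0
      · have := h x h0
        rw [cmp_self_eq_eq, eq_comm, cmp_eq_eq_iff] at this
        exact absurd this hxy.ne
      · have := h y h0
        rw [cmp_self_eq_eq, cmp_eq_eq_iff] at this
        exact absurd this hxy.ne'
    · exact h0
  have conv : ∀ u v : L, 0 < u * v → sign u = sign v := by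
    intro u v huv
    rcases pos_and_pos_or_neg_and_neg_of_mul_pos huv with ⟨h1, h2⟩ | ⟨h1, h2⟩
    · rw [sign_pos h1, sign_pos h2]
    · rw [sign_neg h1, sign_neg h2]
  rcases lt_trichotomy x y with hxy | rfl | hxy
  · exact conv _ _ (key x y hxy h)
  · rfl
  · exact (conv _ _ (key y x hxy fun w hw => (h w hw).symm)).symm

theorem exists_forall_le_eval (p : L[X]) (hd : 0 < p.natDegree)
    (hlc : 0 < p.leadingCoeff) (N : L) : ∃ B, ∀ x, B ≤ x → N ≤ p.eval x := by
  induction hn : p.natDegree generalizing p N with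
  | zero => omega
  | succ n ih =>
    have hp : p = p.divX * X + C (p.coeff 0) := (divX_mul_X_add p).symm
    have hdeg : p.divX.natDegree = n := by rw [natDegree_divX_eq_natDegree_tsub_one]; omega
    have hlc' : p.divX.leadingCoeff = p.leadingCoeff := by
      rw [leadingCoeff, leadingCoeff, hdeg, coeff_divX, hn]
    obtain ⟨ε, hε, B, hB⟩ : ∃ ε > 0, ∃ B, ∀ x, B ≤ x → ε ≤ p.divX.eval x := by
      rcases Nat.eq_zero_or_pos n with rfl | hpos
      · refine ⟨p.leadingCoeff, hlc, 0, fun x _ => ?_⟩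
        rw [eq_C_of_natDegree_eq_zero hdeg, eval_C, ← hlc', leadingCoeff, hdeg]
      · obtain ⟨B, hB⟩ := ih p.divX (by omega) (by rwa [hlc']) 1 hdeg
        exact ⟨1, one_pos, B, hB⟩
    refine ⟨max (max B 0) ((N - p.coeff 0) / ε), fun x hx => ?_⟩
    have h1 : B ≤ x := le_trans (le_max_left _ _) (le_trans (le_max_left _ _) hx)
    have h2 : 0 ≤ x := le_trans (le_max_right _ _) (le_trans (le_max_left _ _) hx)
    have h3 : N - p.coeff 0 ≤ x * ε := (div_le_iff₀ hε).1 (le_trans (le_max_right _ _) hx)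
    have h4 := mul_le_mul_of_nonneg_right (hB x h1) h2
    have h5 : p.eval x = p.divX.eval x * x + p.coeff 0 := by
      conv_lhs => rw [hp]
      simp
    rw [h5]; linarith

/-- Eventually a nonconstant polynomial has the sign of its leading coefficient. -/
theorem exists_forall_sign_eval_eq (p : L[X]) (hd : 0 < p.natDegree) :
    ∃ B, ∀ x, B ≤ x → sign (p.eval x) = sign p.leadingCoeff := by
  have hp : p ≠ 0 := by rintro rfl; simp at hd
  rcases lt_or_gt_of_ne (leadingCoeff_ne_zero.2 hp) with h | h
  · obtain ⟨B, hB⟩ := exists_forall_le_eval (-p) (by simpa) (by simpa using h) 1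
    refine ⟨B, fun x hx => ?_⟩
    have := hB x hx
    rw [eval_neg] at this
    rw [sign_neg h, sign_neg (by linarith)]
  · obtain ⟨B, hB⟩ := exists_forall_le_eval p hd h 1
    refine ⟨B, fun x hx => ?_⟩
    rw [sign_pos h, sign_pos (by linarith [hB x hx])]

theorem exists_forall_sign_eval_eq_bot (p : L[X]) (hd : 0 < p.natDegree) :
    ∃ B, ∀ x, x ≤ B → sign (p.eval x) = sign ((-1) ^ p.natDegree * p.leadingCoeff) := by
  obtain ⟨B, hB⟩ := exists_forall_sign_eval_eq (p.comp (-X)) (by simpa [natDegree_comp] using hd)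
  refine ⟨-B, fun x hx => ?_⟩
  have := hB (-x) (by linarith)
  rw [leadingCoeff_comp (by simp)] at this
  simpa [mul_comm] using this

end Polynomial

namespace Polynomial

open SignType

set_option linter.unusedSectionVars false

variable {L L' : Type}
  [Field L'] [LinearOrder L'] [IsStrictOrderedRing L']
  [Field L] [LinearOrder L] [IsStrictOrderedRing L]

/-- The point `z` has the same position relative to the first components of `Γ` as `w` has
relative to the second components. -/
def SamePosition (Γ : Finset (L × L')) (z : L) (w : L') : Prop :=
  ∀ a ∈ Γ, cmp a.1 z = cmp a.2 w

/-- A finite partial order isomorphism `Γ` matching the sign diagrams of the pairs of polynomials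
in `F`. -/
structure SignMatch (F : Set (L[X] × L'[X])) (Γ : Finset (L × L')) : Prop where
  pos : ∀ a ∈ Γ, SamePosition Γ a.1 a.2
  sign_eval_eq : ∀ z z', SamePosition Γ z z' → ∀ p ∈ F, sign (p.1.eval z) = sign (p.2.eval z')
  fst : ∀ p ∈ F, p.1 ≠ 0 → ∀ x, p.1.eval x = 0 → ∃ a ∈ Γ, a.1 = x
  snd : ∀ p ∈ F, p.2 ≠ 0 → ∀ x, p.2.eval x = 0 → ∃ a ∈ Γ, a.2 = x

theorem SignMatch.exists_samePosition {F : Set (L[X] × L'[X])} {Γ : Finset (L × L')}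
    (h : SignMatch F Γ) (z : L) : ∃ z', SamePosition Γ z z' :=
  Order.PartialIso.exists_across ⟨Γ, fun p hp q hq => h.pos q hq p hp⟩ z

theorem SignMatch.mono {F : Set (L[X] × L'[X])} {Γ Γ' : Finset (L × L')}
    (h : SignMatch F Γ) (hΓ : Γ ⊆ Γ') (hpos : ∀ a ∈ Γ', SamePosition Γ' a.1 a.2) :
    SignMatch F Γ' where
  pos := hpos
  sign_eval_eq z z' hz := h.sign_eval_eq z z' fun a ha => hz a (hΓ ha)
  fst p hp hp0 x hx := (h.fst p hp hp0 x hx).imp fun _ ha => ⟨hΓ ha.1, ha.2⟩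
  snd p hp hp0 x hx := (h.snd p hp hp0 x hx).imp fun _ ha => ⟨hΓ ha.1, ha.2⟩

theorem SignMatch.subset {F G : Set (L[X] × L'[X])} {Γ : Finset (L × L')}
    (h : SignMatch F Γ) (hGF : G ⊆ F) : SignMatch G Γ where
  pos := h.pos
  sign_eval_eq z z' hz p hp := h.sign_eval_eq z z' hz p (hGF hp)
  fst p hp := h.fst p (hGF hp)
  snd p hp := h.snd p (hGF hp)

open Classical in
/-- Only the pairs that are roots of polynomials in `F` are needed to match `F`. -/
theorem SignMatch.restrict (hL' : PolyIVT L')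
    {F : Set (L[X] × L'[X])} {Γ : Finset (L × L')} (h : SignMatch F Γ)
    (h0 : ∀ p ∈ F, p.1 = 0 ↔ p.2 = 0) :
    SignMatch F (Γ.filter fun a => ∃ p ∈ F, p.1 ≠ 0 ∧ p.1.eval a.1 = 0) := by
  have hsnd : ∀ p ∈ F, p.2 ≠ 0 → ∀ x, p.2.eval x = 0 →
      ∃ a ∈ Γ.filter fun a => ∃ p ∈ F, p.1 ≠ 0 ∧ p.1.eval a.1 = 0, a.2 = x := by
    intro p hp hp0 x hx
    obtain ⟨a, ha, rfl⟩ := h.snd p hp hp0 x hx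
    refine ⟨a, Finset.mem_filter.2 ⟨ha, p, hp, mt (h0 p hp).1 hp0, ?_⟩, rfl⟩
    have := h.sign_eval_eq a.1 a.2 (h.pos a ha) p hp
    rwa [hx, sign_zero, sign_eq_zero_iff] at this
  refine ⟨fun a ha b hb => h.pos a (Finset.mem_filter.1 ha).1 b (Finset.mem_filter.1 hb).1,
    fun z z' hz p hp => ?_, fun p hp hp0 x hx => ?_, hsnd⟩
  · obtain ⟨z'', hz''⟩ := h.exists_samePosition z
    rw [h.sign_eval_eq z z'' hz'' p hp]
    by_cases hp0 : p.2 = 0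
    · simp [hp0]
    refine hL'.sign_eq p.2 fun w hw => ?_
    obtain ⟨a, ha, rfl⟩ := hsnd p hp hp0 w hw
    rw [← hz a ha, hz'' a (Finset.mem_filter.1 ha).1]
  · obtain ⟨a, ha, rfl⟩ := h.fst p hp hp0 x hx
    exact ⟨a, Finset.mem_filter.2 ⟨ha, p, hp, hp0, hx⟩, rfl⟩

theorem exists_matching_root (hL : PolyIVT L) (hL' : PolyIVT L') {Γ : Finset (L × L')}
    (hΓ : ∀ a ∈ Γ, SamePosition Γ a.1 a.2) {f : L[X]} {f' : L'[X]}
    (hsign : ∀ a ∈ Γ, sign (f.eval a.1) = sign (f'.eval a.2))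
    (hder : ∀ w, f.derivative.eval w = 0 → ∃ a ∈ Γ, a.1 = w) {z : L}
    (hlo : ∃ a ∈ Γ, a.1 < z) (hhi : ∃ a ∈ Γ, z < a.1) (hz : f.eval z = 0) :
    ∃ z', f'.eval z' = 0 ∧ SamePosition Γ z z' := by
  classical
  by_cases hzΓ : ∃ a ∈ Γ, a.1 = z
  · obtain ⟨a, ha, rfl⟩ := hzΓ
    refine ⟨a.2, ?_, hΓ a ha⟩
    have := hsign a ha
    rw [hz, sign_zero] at this
    exact sign_eq_zero_iff.1 this.symm
  push Not at hzΓ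
  obtain ⟨x, hx, hxmax⟩ := (Γ.filter fun a => a.1 < z).exists_max_image Prod.fst
    (by obtain ⟨a, ha, h⟩ := hlo; exact ⟨a, Finset.mem_filter.2 ⟨ha, h⟩⟩)
  obtain ⟨y, hy, hymin⟩ := (Γ.filter fun a => z < a.1).exists_min_image Prod.fst
    (by obtain ⟨a, ha, h⟩ := hhi; exact ⟨a, Finset.mem_filter.2 ⟨ha, h⟩⟩)
  obtain ⟨hxΓ, hxz⟩ := Finset.mem_filter.1 hx
  obtain ⟨hyΓ, hzy⟩ := Finset.mem_filter.1 hy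
  have hgap : ∀ a ∈ Γ, a.1 ≤ x.1 ∨ y.1 ≤ a.1 := by
    intro a ha
    rcases lt_or_gt_of_ne (hzΓ a ha) with h | h
    · exact Or.inl (hxmax a (Finset.mem_filter.2 ⟨ha, h⟩))
    · exact Or.inr (hymin a (Finset.mem_filter.2 ⟨ha, h⟩))
  have hnod : ∀ w, x.1 < w → w < y.1 → f.derivative.eval w ≠ 0 := by
    intro w h1 h2 h3
    obtain ⟨a, ha, rfl⟩ := hder w h3
    rcases hgap a ha with h | h
    · exact absurd h1 (not_lt.2 h)
    · exact absurd h2 (not_lt.2 h)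
  obtain ⟨c, hc1, hc2, hc⟩ := hL.exists_deriv_eq_slope f hxz
  obtain ⟨d, hd1, hd2, hd⟩ := hL.exists_deriv_eq_slope f hzy
  have hcd : 0 < f.derivative.eval c * f.derivative.eval d := by
    rcases lt_trichotomy (f.derivative.eval c * f.derivative.eval d) 0 with h | h | h
    · obtain ⟨w, h1, h2, h3⟩ := hL _ c d (hc2.trans hd1) h
      exact absurd h3 (hnod w (hc1.trans h1) (h2.trans hd2))
    · rcases mul_eq_zero.1 h with h | h
      · exact absurd h (hnod c hc1 (hc2.trans hzy))
      · exact absurd h (hnod d (hxz.trans hd1) hd2)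
    · exact h
  have hxy : f.eval x.1 * f.eval y.1 < 0 := by
    have e : f.eval x.1 * f.eval y.1 =
        -((f.derivative.eval c * f.derivative.eval d) * ((z - x.1) * (y.1 - z))) := by
      rw [hz] at hc hd
      have h1 : f.eval x.1 = -(f.derivative.eval c * (z - x.1)) := by linear_combination -hc
      have h2 : f.eval y.1 = f.derivative.eval d * (y.1 - z) := by linear_combination hd
      rw [h1, h2]; ring
    rw [e, neg_lt_zero]
    exact mul_pos hcd (mul_pos (sub_pos.2 hxz) (sub_pos.2 hzy))
  have hxy' : f'.eval x.2 * f'.eval y.2 < 0 := by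
    rw [← sign_eq_neg_one_iff] at hxy ⊢
    rwa [sign_mul, ← hsign x hxΓ, ← hsign y hyΓ, ← sign_mul]
  have key : ∀ a ∈ Γ, ∀ b ∈ Γ, a.1 ≤ b.1 → a.2 ≤ b.2 := by
    intro a ha b hb hab
    rw [← not_lt, ← cmp_eq_gt_iff] at hab ⊢
    rwa [← hΓ b hb a ha]
  have hlt : x.2 < y.2 := by
    rw [← cmp_eq_lt_iff, ← hΓ y hyΓ x hxΓ, cmp_eq_lt_iff]
    exact hxz.trans hzy
  obtain ⟨z', h1, h2, h3⟩ := hL' f' x.2 y.2 hlt hxy'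
  refine ⟨z', h3, fun a ha => ?_⟩
  rcases hgap a ha with h | h
  · rw [(cmp_eq_lt_iff _ _).2 (h.trans_lt hxz),
      (cmp_eq_lt_iff _ _).2 ((key a ha x hxΓ h).trans_lt h1)]
  · rw [(cmp_eq_gt_iff _ _).2 (hzy.trans_le h),
      (cmp_eq_gt_iff _ _).2 (h2.trans_le (key y hyΓ a ha h))]

theorem lt_of_samePosition (hL : PolyIVT L) {Γ : Finset (L × L')} {f : L[X]}
    (hder : ∀ w, f.derivative.eval w = 0 → ∃ a ∈ Γ, a.1 = w) {z w : L} {z' w' : L'}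
    (hz : SamePosition Γ z z') (hw : SamePosition Γ w w')
    (hfz : f.eval z = 0) (hfw : f.eval w = 0) (h : z < w) : z' < w' := by
  obtain ⟨y, h1, h2, h3⟩ := hL.rolle f h hfz hfw
  obtain ⟨a, ha, rfl⟩ := hder y h3
  have h4 := hz a ha
  have h5 := hw a ha
  rw [(cmp_eq_gt_iff _ _).2 h1, eq_comm, cmp_eq_gt_iff] at h4
  rw [(cmp_eq_lt_iff _ _).2 h2, eq_comm, cmp_eq_lt_iff] at h5
  exact h4.trans h5

/-- Every position relative to the roots of `f` is realised by a point of `Γ`. -/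
theorem exists_sample (hL : PolyIVT L) {Γ : Finset (L × L')} {f : L[X]} (hf : f ≠ 0)
    (hder : ∀ w, f.derivative.eval w = 0 → ∃ a ∈ Γ, a.1 = w)
    (hroot : ∀ w, f.eval w = 0 → ∃ a ∈ Γ, a.1 = w)
    (hlo : ∃ a ∈ Γ, ∀ w, f.eval w = 0 → a.1 < w) (hhi : ∃ a ∈ Γ, ∀ w, f.eval w = 0 → w < a.1)
    (z : L) : ∃ a ∈ Γ, ∀ w, f.eval w = 0 → cmp w z = cmp w a.1 := by
  classical
  by_cases hz : f.eval z = 0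
  · obtain ⟨a, ha, rfl⟩ := hroot z hz
    exact ⟨a, ha, fun _ _ => rfl⟩
  have hne : ∀ w, f.eval w = 0 → w ≠ z := by rintro w hw rfl; exact hz hw
  by_cases h1 : ∃ w, f.eval w = 0 ∧ w < z
  swap
  · push Not at h1
    obtain ⟨a, ha, h⟩ := hlo
    refine ⟨a, ha, fun w hw => ?_⟩
    rw [(cmp_eq_gt_iff _ _).2 ((h1 w hw).lt_of_ne (hne w hw).symm), (cmp_eq_gt_iff _ _).2 (h w hw)]
  by_cases h2 : ∃ w, f.eval w = 0 ∧ z < w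
  swap
  · push Not at h2
    obtain ⟨a, ha, h⟩ := hhi
    refine ⟨a, ha, fun w hw => ?_⟩
    rw [(cmp_eq_lt_iff _ _).2 ((h2 w hw).lt_of_ne (hne w hw)), (cmp_eq_lt_iff _ _).2 (h w hw)]
  have hmem : ∀ w, w ∈ f.roots.toFinset ↔ f.eval w = 0 := by simp [hf]
  obtain ⟨x, hx, hxmax⟩ := (f.roots.toFinset.filter (· < z)).exists_max_image id
    (by obtain ⟨a, ha, h⟩ := h1; exact ⟨a, Finset.mem_filter.2 ⟨(hmem a).2 ha, h⟩⟩)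
  obtain ⟨y, hy, hymin⟩ := (f.roots.toFinset.filter (z < ·)).exists_min_image id
    (by obtain ⟨a, ha, h⟩ := h2; exact ⟨a, Finset.mem_filter.2 ⟨(hmem a).2 ha, h⟩⟩)
  rw [Finset.mem_filter, hmem] at hx hy
  obtain ⟨c, hc1, hc2, hc⟩ := hL.rolle f (hx.2.trans hy.2) hx.1 hy.1
  obtain ⟨a, ha, rfl⟩ := hder c hc
  refine ⟨a, ha, fun w hw => ?_⟩
  rcases lt_or_gt_of_ne (hne w hw) with h | h
  · have : w ≤ x := hxmax w (Finset.mem_filter.2 ⟨(hmem w).2 hw, h⟩)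
    rw [(cmp_eq_lt_iff _ _).2 h, (cmp_eq_lt_iff _ _).2 (lt_of_le_of_lt this hc1)]
  · have : y ≤ w := hymin w (Finset.mem_filter.2 ⟨(hmem w).2 hw, h⟩)
    rw [(cmp_eq_gt_iff _ _).2 h, (cmp_eq_gt_iff _ _).2 (lt_of_lt_of_le hc2 this)]

end Polynomial

namespace Polynomial

open SignType

set_option linter.unusedSectionVars false

variable {L L' : Type}
  [Field L'] [LinearOrder L'] [IsStrictOrderedRing L']
  [Field L] [LinearOrder L] [IsStrictOrderedRing L]

theorem SamePosition.swap {Γ : Finset (L × L')} {z : L} {z' : L'} (h : SamePosition Γ z z') :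
    SamePosition (Γ.map (Equiv.prodComm L L').toEmbedding) z' z := by
  intro a ha
  obtain ⟨b, hb, rfl⟩ := Finset.mem_map.1 ha
  exact (h b hb).symm

open Classical in
theorem SamePosition.insert {Γ : Finset (L × L')} (hΓ : ∀ a ∈ Γ, SamePosition Γ a.1 a.2)
    {c : L × L'} (hc : SamePosition Γ c.1 c.2) :
    ∀ a ∈ insert c Γ, SamePosition (insert c Γ) a.1 a.2 := by
  intro a ha b hb
  rcases Finset.mem_insert.1 ha with rfl | ha' <;> rcases Finset.mem_insert.1 hb with rfl | hb'
  · simp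
  · exact hc b hb'
  · rw [← cmp_swap a.1, ← cmp_swap a.2, hc a ha']
  · exact hΓ a ha' b hb'

theorem exists_ge_forall_lt (s : Finset L) (B : L) : ∃ M, B ≤ M ∧ ∀ x ∈ s, x < M := by
  classical
  obtain ⟨M, hM⟩ := (insert B s).exists_le
  exact ⟨M + 1, (hM B (s.mem_insert_self B)).trans (by linarith),
    fun x hx => (hM x (Finset.mem_insert_of_mem hx)).trans_lt (by linarith)⟩

theorem exists_le_forall_lt (s : Finset L) (B : L) : ∃ M, M ≤ B ∧ ∀ x ∈ s, M < x := by
  classical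
  obtain ⟨M, hM⟩ : ∃ M : L, ∀ x ∈ insert B s, M ≤ x := Finset.exists_le (α := Lᵒᵈ) (insert B s)
  exact ⟨M - 1, le_trans (by linarith) (hM B (s.mem_insert_self B)),
    fun x hx => lt_of_lt_of_le (by linarith) (hM x (Finset.mem_insert_of_mem hx))⟩

/-- If the sign diagrams of `F`, which contains the derivative of a pair `(f, f')`, are matched,
then `(f, f')` can be added to `F`. -/
theorem SignMatch.exists_insert (hL : PolyIVT L) (hL' : PolyIVT L')
    {F : Set (L[X] × L'[X])} {Γ : Finset (L × L')} (h : SignMatch F Γ) {f : L[X]} {f' : L'[X]}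
    (hd : (f.derivative, f'.derivative) ∈ F)
    (hs : ∀ a ∈ Γ, sign (f.eval a.1) = sign (f'.eval a.2))
    (hdeg : f.natDegree = f'.natDegree) (hpos : 0 < f.natDegree)
    (hlc : sign f.leadingCoeff = sign f'.leadingCoeff) :
    ∃ Γ', SignMatch (insert (f, f') F) Γ' := by
  classical
  have hf : f ≠ 0 := by rintro rfl; simp at hpos
  have hf' : f' ≠ 0 := by rintro rfl; simp [hdeg] at hpos
  have hdf : f.derivative ≠ 0 := fun h0 => by
    have := derivative_eq_zero.1 h0; omega
  have hdf' : f'.derivative ≠ 0 := fun h0 => by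
    have := derivative_eq_zero.1 h0; omega
  have hder : ∀ w, f.derivative.eval w = 0 → ∃ a ∈ Γ, a.1 = w := h.fst _ hd hdf
  have hder' : ∀ w, f'.derivative.eval w = 0 → ∃ a ∈ Γ, a.2 = w := h.snd _ hd hdf'
  have hmem : ∀ w, w ∈ f.roots.toFinset ↔ f.eval w = 0 := by simp [hf]
  have hmem' : ∀ w, w ∈ f'.roots.toFinset ↔ f'.eval w = 0 := by simp [hf']
  obtain ⟨B, hB⟩ := exists_forall_sign_eval_eq f hpos
  obtain ⟨B', hB'⟩ := exists_forall_sign_eval_eq f' (hdeg ▸ hpos)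
  obtain ⟨b, hb⟩ := exists_forall_sign_eval_eq_bot f hpos
  obtain ⟨b', hb'⟩ := exists_forall_sign_eval_eq_bot f' (hdeg ▸ hpos)
  obtain ⟨M, hM, hMΓ⟩ := exists_ge_forall_lt (Γ.image Prod.fst ∪ f.roots.toFinset) B
  obtain ⟨M', hM', hMΓ'⟩ := exists_ge_forall_lt (Γ.image Prod.snd ∪ f'.roots.toFinset) B'
  obtain ⟨m, hm, hmΓ⟩ := exists_le_forall_lt (insert M (Γ.image Prod.fst ∪ f.roots.toFinset)) b
  obtain ⟨m', hm', hmΓ'⟩ :=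
    exists_le_forall_lt (insert M' (Γ.image Prod.snd ∪ f'.roots.toFinset)) b'
  simp only [Finset.mem_insert, Finset.mem_union, Finset.mem_image, hmem,
    hmem'] at hMΓ hMΓ' hmΓ hmΓ'
  set Γ₂ := insert (m, m') (insert (M, M') Γ) with hΓ₂
  have hsub : Γ ⊆ Γ₂ := (Finset.subset_insert _ _).trans (Finset.subset_insert _ _)
  have hmΓ₂ : (m, m') ∈ Γ₂ := Finset.mem_insert_self _ _
  have hMΓ₂ : (M, M') ∈ Γ₂ := Finset.mem_insert_of_mem (Finset.mem_insert_self _ _)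
  have hpos₂ : ∀ a ∈ Γ₂, SamePosition Γ₂ a.1 a.2 := by
    refine SamePosition.insert (SamePosition.insert h.pos fun a ha => ?_) fun a ha => ?_
    · rw [(cmp_eq_lt_iff _ _).2 (hMΓ a.1 (Or.inl ⟨a, ha, rfl⟩)),
        (cmp_eq_lt_iff _ _).2 (hMΓ' a.2 (Or.inl ⟨a, ha, rfl⟩))]
    · rcases Finset.mem_insert.1 ha with rfl | ha
      · rw [(cmp_eq_gt_iff _ _).2 (hmΓ M (Or.inl rfl)),
          (cmp_eq_gt_iff _ _).2 (hmΓ' M' (Or.inl rfl))]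
      · rw [(cmp_eq_gt_iff _ _).2 (hmΓ a.1 (Or.inr (Or.inl ⟨a, ha, rfl⟩))),
          (cmp_eq_gt_iff _ _).2 (hmΓ' a.2 (Or.inr (Or.inl ⟨a, ha, rfl⟩)))]
  have hs₂ : ∀ a ∈ Γ₂, sign (f.eval a.1) = sign (f'.eval a.2) := by
    intro a ha
    rcases Finset.mem_insert.1 ha with rfl | ha
    · rw [hb m hm, hb' m' hm', sign_mul, sign_mul, hlc, hdeg, sign_pow, sign_pow]
      simp
    rcases Finset.mem_insert.1 ha with rfl | ha
    · rw [hB M hM, hB' M' hM', hlc]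
    · exact hs a ha
  have hder₂ : ∀ w, f.derivative.eval w = 0 → ∃ a ∈ Γ₂, a.1 = w := fun w hw =>
    (hder w hw).imp fun a ha => ⟨hsub ha.1, ha.2⟩
  have hder₂' : ∀ w, f'.derivative.eval w = 0 →
      ∃ a ∈ Γ₂.map (Equiv.prodComm L L').toEmbedding, a.1 = w := fun w hw => by
    obtain ⟨a, ha, rfl⟩ := hder' w hw
    exact ⟨a.swap, Finset.mem_map.2 ⟨a, hsub ha, rfl⟩, rfl⟩
  set R := (f.roots.toFinset ×ˢ f'.roots.toFinset).filter fun a => SamePosition Γ₂ a.1 a.2 with hR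
  have hmemR : ∀ a, a ∈ R ↔ (f.eval a.1 = 0 ∧ f'.eval a.2 = 0) ∧ SamePosition Γ₂ a.1 a.2 := by
    intro a
    rw [hR, Finset.mem_filter, Finset.mem_product, hmem, hmem']
  have hroot : ∀ w, f.eval w = 0 → ∃ a ∈ R, a.1 = w := by
    intro w hw
    obtain ⟨w', hw', hww⟩ := exists_matching_root hL hL' hpos₂ hs₂ hder₂
      ⟨_, hmΓ₂, hmΓ w (Or.inr (Or.inr hw))⟩ ⟨_, hMΓ₂, hMΓ w (Or.inr hw)⟩ hw
    exact ⟨(w, w'), (hmemR _).2 ⟨⟨hw, hw'⟩, hww⟩, rfl⟩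
  have hroot' : ∀ w, f'.eval w = 0 → ∃ a ∈ R, a.2 = w := by
    intro w hw
    obtain ⟨w', hw', hww⟩ := exists_matching_root (f' := f) hL' hL
      (Γ := Γ₂.map (Equiv.prodComm L L').toEmbedding)
      (by
        intro a ha
        obtain ⟨c, hc, rfl⟩ := Finset.mem_map.1 ha
        exact (hpos₂ c hc).swap)
      (by
        intro a ha
        obtain ⟨c, hc, rfl⟩ := Finset.mem_map.1 ha
        exact (hs₂ c hc).symm) hder₂'
      ⟨_, Finset.mem_map.2 ⟨_, hmΓ₂, rfl⟩, hmΓ' w (Or.inr (Or.inr hw))⟩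
      ⟨_, Finset.mem_map.2 ⟨_, hMΓ₂, rfl⟩, hMΓ' w (Or.inr hw)⟩ hw
    exact ⟨(w', w), (hmemR _).2 ⟨⟨hw', hw⟩, fun a ha =>
      (hww a.swap (Finset.mem_map.2 ⟨a, ha, rfl⟩)).symm⟩, rfl⟩
  have hlt : ∀ a ∈ R, ∀ c ∈ R, a.1 < c.1 → a.2 < c.2 := fun a ha c hc hac =>
    lt_of_samePosition hL hder₂ ((hmemR a).1 ha).2 ((hmemR c).1 hc).2
      ((hmemR a).1 ha).1.1 ((hmemR c).1 hc).1.1 hac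
  have hlt' : ∀ a ∈ R, ∀ c ∈ R, a.2 < c.2 → a.1 < c.1 := fun a ha c hc hac =>
    lt_of_samePosition hL' hder₂' ((hmemR a).1 ha).2.swap ((hmemR c).1 hc).2.swap
      ((hmemR a).1 ha).1.2 ((hmemR c).1 hc).1.2 hac
  set Γ₃ := Γ₂ ∪ R with hΓ₃
  have hsub₂ : Γ₂ ⊆ Γ₃ := Finset.subset_union_left
  have hsubR : R ⊆ Γ₃ := Finset.subset_union_right
  have hpos₃ : ∀ a ∈ Γ₃, SamePosition Γ₃ a.1 a.2 := by
    intro a ha c hc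
    rcases Finset.mem_union.1 hc with hc | hc
    · rcases Finset.mem_union.1 ha with ha | ha
      · exact hpos₂ a ha c hc
      · exact ((hmemR a).1 ha).2 c hc
    · rcases Finset.mem_union.1 ha with ha | ha
      · rw [← cmp_swap a.1, ← cmp_swap a.2, ((hmemR c).1 hc).2 a ha]
      · rcases lt_trichotomy c.1 a.1 with h1 | h1 | h1
        · rw [(cmp_eq_lt_iff _ _).2 h1, (cmp_eq_lt_iff _ _).2 (hlt c hc a ha h1)]
        · rcases lt_trichotomy c.2 a.2 with h2 | h2 | h2
          · exact absurd (hlt' c hc a ha h2) (by rw [h1]; exact lt_irrefl _)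
          · rw [(cmp_eq_eq_iff _ _).2 h1, (cmp_eq_eq_iff _ _).2 h2]
          · exact absurd (hlt' a ha c hc h2) (by rw [h1]; exact lt_irrefl _)
        · rw [(cmp_eq_gt_iff _ _).2 h1, (cmp_eq_gt_iff _ _).2 (hlt a ha c hc h1)]
  have hs₃ : ∀ a ∈ Γ₃, sign (f.eval a.1) = sign (f'.eval a.2) := by
    intro a ha
    rcases Finset.mem_union.1 ha with ha | ha
    · exact hs₂ a ha
    · rw [((hmemR a).1 ha).1.1, ((hmemR a).1 ha).1.2, sign_zero, sign_zero]
  have h₃ := h.mono (hsub.trans hsub₂) hpos₃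
  refine ⟨Γ₃, hpos₃, ?_, ?_, ?_⟩
  · intro z z' hz p hp
    rcases hp with rfl | hp
    · obtain ⟨a, ha, haz⟩ := exists_sample hL (Γ := Γ₃) hf
        (fun w hw => (hder₂ w hw).imp fun a ha => ⟨hsub₂ ha.1, ha.2⟩)
        (fun w hw => (hroot w hw).imp fun a ha => ⟨hsubR ha.1, ha.2⟩)
        ⟨_, hsub₂ hmΓ₂, fun w hw => hmΓ w (Or.inr (Or.inr hw))⟩
        ⟨_, hsub₂ hMΓ₂, fun w hw => hMΓ w (Or.inr hw)⟩ z
      change sign (f.eval z) = sign (f'.eval z')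
      rw [hL.sign_eq f haz, hs₃ a ha]
      refine hL'.sign_eq f' fun w hw => ?_
      obtain ⟨c, hc, rfl⟩ := hroot' w hw
      rw [← hz c (hsubR hc), ← hpos₃ a ha c (hsubR hc)]
      exact (haz c.1 ((hmemR c).1 hc).1.1).symm
    · exact h₃.sign_eval_eq z z' hz p hp
  · intro p hp hp0 x hx
    rcases hp with rfl | hp
    · exact (hroot x hx).imp fun a ha => ⟨hsubR ha.1, ha.2⟩
    · exact h₃.fst p hp hp0 x hx
  · intro p hp hp0 x hx
    rcases hp with rfl | hp
    · exact (hroot' x hx).imp fun a ha => ⟨hsubR ha.1, ha.2⟩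
    · exact h₃.snd p hp hp0 x hx

end Polynomial

namespace Polynomial

open SignType

set_option linter.unusedSectionVars false

variable {A L L' : Type} [CommRing A]
  [Field L'] [LinearOrder L'] [IsStrictOrderedRing L']
  [Field L] [LinearOrder L] [IsStrictOrderedRing L]

/-- Pseudo-division by `p`, with an even power of the leading coefficient. -/
theorem exists_pseudo_division (f p : A[X]) :
    ∃ (e : ℕ) (q r : A[X]), C (p.leadingCoeff ^ (2 * e)) * f = p * q + r ∧
      (r = 0 ∨ r.natDegree < p.natDegree) := by
  rcases Nat.eq_zero_or_pos p.natDegree with hp | hp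
  · obtain ⟨c, rfl⟩ := natDegree_eq_zero.1 hp
    exact ⟨1, C c * f, 0, by simp; ring, Or.inl rfl⟩
  induction hn : f.natDegree using Nat.strong_induction_on generalizing f with
  | _ n ih =>
    rcases lt_or_ge f.natDegree p.natDegree with h | h
    · exact ⟨0, 0, f, by simp, Or.inr h⟩
    · have hlt : (C p.leadingCoeff * p.cancelLeads f).natDegree < n :=
        (natDegree_C_mul_le _ _).trans_lt
          (hn ▸ natDegree_cancelLeads_lt_of_natDegree_le_natDegree h (hp.trans_le h))
      obtain ⟨e, q, r, h1, h2⟩ := ih _ hlt _ rfl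
      refine ⟨e + 1, q + C (p.leadingCoeff ^ (2 * e)) * (C p.leadingCoeff *
        (C f.leadingCoeff * X ^ (f.natDegree - p.natDegree))), r, ?_, h2⟩
      rw [cancelLeads, Nat.sub_eq_zero_of_le h] at h1
      simp only [map_pow, pow_zero, mul_one] at h1 ⊢
      linear_combination h1

theorem map_eraseLead_of_leadingCoeff_eq_zero {B : Type} [CommRing B] {φ : A →+* B} {p : A[X]}
    (h : φ p.leadingCoeff = 0) : p.eraseLead.map φ = p.map φ := by
  have := congrArg (Polynomial.map φ) (eraseLead_add_monomial_natDegree_leadingCoeff p)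
  rwa [Polynomial.map_add, map_monomial, h, monomial_zero_right, add_zero] at this

theorem exists_iterate_eraseLead (φ : A →+* L) (φ' : A →+* L') (N : ℕ) :
    ∀ p : A[X], p.support.card ≤ N → (∀ i, φ (p.coeff i) = 0 ↔ φ' (p.coeff i) = 0) →
      p.map φ ≠ 0 → ∃ j ≤ N, (eraseLead^[j] p).map φ = p.map φ ∧
        (eraseLead^[j] p).map φ' = p.map φ' ∧ φ (eraseLead^[j] p).leadingCoeff ≠ 0 ∧
        φ' (eraseLead^[j] p).leadingCoeff ≠ 0 := by
  induction N with
  | zero =>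
    intro p hp _ h0
    rw [Nat.le_zero, Finset.card_eq_zero, support_eq_empty] at hp
    simp [hp] at h0
  | succ N ih =>
    intro p hp hc h0
    by_cases hl : φ p.leadingCoeff = 0
    · have hl' := (hc _).1 hl
      have h1 := map_eraseLead_of_leadingCoeff_eq_zero hl
      have h1' := map_eraseLead_of_leadingCoeff_eq_zero hl'
      have hp0 : p ≠ 0 := by rintro rfl; simp at h0
      obtain ⟨j, hj, h2, h3, h4⟩ := ih p.eraseLead
        (by have := eraseLead_support_card_lt hp0; omega)
        (fun i => by rw [eraseLead_coeff]; split_ifs; exacts [by simp, hc i]) (h1 ▸ h0)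
      exact ⟨j + 1, by omega, by rw [Function.iterate_succ_apply, h2, h1],
        by rw [Function.iterate_succ_apply, h3, h1'], by simpa using h4⟩
    · exact ⟨0, by omega, rfl, rfl, hl, mt (hc _).2 hl⟩

theorem natDegree_iterate_eraseLead_le (p : A[X]) (j : ℕ) :
    (eraseLead^[j] p).natDegree ≤ p.natDegree := by
  induction j generalizing p with
  | zero => exact le_rfl
  | succ j ih => exact (ih _).trans ((eraseLead_natDegree_le p).trans (Nat.sub_le _ _))

theorem sign_eq_of_pseudo_division {φ : A →+* L} {f p q r : A[X]} {e : ℕ}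
    (h : C (p.leadingCoeff ^ (2 * e)) * f = p * q + r) (hp : φ p.leadingCoeff ≠ 0) {x : L}
    (hx : (p.map φ).eval x = 0) : sign ((f.map φ).eval x) = sign ((r.map φ).eval x) := by
  have h1 := congrArg (fun g => (g.map φ).eval x) h
  simp only [Polynomial.map_mul, Polynomial.map_add, eval_mul, eval_add, hx, zero_mul, zero_add,
    Polynomial.map_C, eval_C] at h1
  rw [← h1, sign_mul, map_pow, pow_mul, sign_pos (pow_pos (sq_pos_of_ne_zero hp) _), one_mul]

theorem sign_coeff_eq {φ : A →+* L} {φ' : A →+* L'} {p : A[X]}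
    (h : ∀ a ∈ p.coeffs, sign (φ a) = sign (φ' a)) (i : ℕ) :
    sign (φ (p.coeff i)) = sign (φ' (p.coeff i)) := by
  by_cases hi : p.coeff i = 0
  · simp [hi]
  · exact h _ (coeff_mem_coeffs hi)

theorem map_eq_zero_iff_of_sign {φ : A →+* L} {φ' : A →+* L'} {a : A}
    (h : sign (φ a) = sign (φ' a)) : φ a = 0 ↔ φ' a = 0 := by
  rw [← sign_eq_zero_iff, h, sign_eq_zero_iff]

/-- The sign diagram of finitely many polynomials is determined by the signs of finitely many
elements of the coefficient ring. -/
theorem exists_signMatch (hL : PolyIVT L) (hL' : PolyIVT L') (d : ℕ) :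
    ∀ (k : ℕ) (P : Finset A[X]), (∀ p ∈ P, p.natDegree ≤ d) →
      (P.filter fun p => p.natDegree = d).card ≤ k → ∃ S : Finset A,
      ∀ (φ : A →+* L) (φ' : A →+* L'), (∀ a ∈ S, sign (φ a) = sign (φ' a)) →
        ∃ Γ, SignMatch ((fun p => (p.map φ, p.map φ')) '' (P : Set A[X])) Γ := by
  classical
  induction d with
  | zero =>
    intro k P hP _
    refine ⟨P.image fun p => p.coeff 0, fun φ φ' h => ⟨∅, by simp, ?_, ?_, ?_⟩⟩
    · rintro z z' - _ ⟨p, hp, rfl⟩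
      have h1 := h _ (Finset.mem_image_of_mem _ hp)
      have h2 := eq_C_of_natDegree_le_zero (hP p hp)
      rw [h2]
      simpa using h1
    · rintro _ ⟨p, hp, rfl⟩ h0 x hx
      have h2 := eq_C_of_natDegree_le_zero (hP p hp)
      dsimp only at h0 hx
      rw [h2] at h0 hx
      simp at h0 hx
      exact absurd hx h0
    · rintro _ ⟨p, hp, rfl⟩ h0 x hx
      have h2 := eq_C_of_natDegree_le_zero (hP p hp)
      dsimp only at h0 hx
      rw [h2] at h0 hx
      simp at h0 hx
      exact absurd hx h0
  | succ d ihd =>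
    intro k
    induction k with
    | zero =>
      intro P hP hk
      rw [Nat.le_zero, Finset.card_eq_zero, Finset.filter_eq_empty_iff] at hk
      exact ihd _ P (fun p hp => Nat.le_of_lt_succ (lt_of_le_of_ne (hP p hp) (hk hp))) le_rfl
    | succ k ihk =>
      intro P hP hk
      by_cases hf : ∃ f ∈ P, f.natDegree = d + 1
      swap
      · push Not at hf
        exact ihd _ P (fun p hp => Nat.le_of_lt_succ (lt_of_le_of_ne (hP p hp) (hf p hp))) le_rfl
      obtain ⟨f, hfP, hfd⟩ := hf
      choose e q r hr hrd using fun p : A[X] => exists_pseudo_division f p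
      set P₁ := insert f.derivative (insert f.eraseLead (P.erase f)) with hP₁
      set R := (P₁ ×ˢ Finset.range (d + 3)).image fun x => r (eraseLead^[x.2] x.1) with hR
      have hP₁d : ∀ p ∈ P₁, p.natDegree ≤ d + 1 := by
        intro p hp
        rcases Finset.mem_insert.1 hp with rfl | hp
        · exact (natDegree_derivative_le f).trans (by omega)
        rcases Finset.mem_insert.1 hp with rfl | hp
        · exact (eraseLead_natDegree_le f).trans (by omega)
        · exact hP p (Finset.mem_of_mem_erase hp)
      have hRd : ∀ p ∈ R, p.natDegree ≤ d := by
        intro p hp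
        obtain ⟨⟨x, j⟩, hx, rfl⟩ := Finset.mem_image.1 hp
        have h1 := (natDegree_iterate_eraseLead_le x j).trans
          (hP₁d x (Finset.mem_product.1 hx).1)
        rcases hrd (eraseLead^[j] x) with h | h
        · simp [h]
        · dsimp only; omega
      obtain ⟨S, hS⟩ := ihk (P₁ ∪ R)
        (by
          intro p hp
          rcases Finset.mem_union.1 hp with hp | hp
          · exact hP₁d p hp
          · exact (hRd p hp).trans (Nat.le_succ d))
        (by
          have : ((P₁ ∪ R).filter fun p => p.natDegree = d + 1) ⊆
              (P.filter fun p => p.natDegree = d + 1).erase f := by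
            intro p hp
            obtain ⟨hp, hpd⟩ := Finset.mem_filter.1 hp
            rcases Finset.mem_union.1 hp with hp | hp
            · rcases Finset.mem_insert.1 hp with rfl | hp
              · have := natDegree_derivative_le f; omega
              rcases Finset.mem_insert.1 hp with rfl | hp
              · have := eraseLead_natDegree_le f; omega
              · exact Finset.mem_erase.2 ⟨Finset.ne_of_mem_erase hp,
                  Finset.mem_filter.2 ⟨Finset.mem_of_mem_erase hp, hpd⟩⟩
            · have := hRd p hp; omega
          have h1 := Finset.card_le_card this
          rw [Finset.card_erase_of_mem (Finset.mem_filter.2 ⟨hfP, hfd⟩)] at h1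
          omega)
      refine ⟨S ∪ (insert f P₁).biUnion coeffs, fun φ φ' h => ?_⟩
      obtain ⟨Γ, hΓ⟩ := hS φ φ' fun a ha => h a (Finset.mem_union_left _ ha)
      have hco : ∀ p ∈ insert f P₁, ∀ i, sign (φ (p.coeff i)) = sign (φ' (p.coeff i)) :=
        fun p hp => sign_coeff_eq fun a ha =>
          h a (Finset.mem_union_right _ (Finset.mem_biUnion.2 ⟨p, hp, ha⟩))
      have hco0 : ∀ p ∈ insert f P₁, ∀ i, φ (p.coeff i) = 0 ↔ φ' (p.coeff i) = 0 :=
        fun p hp i => map_eq_zero_iff_of_sign (hco p hp i)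
      have hfm := Finset.mem_insert_self f P₁
      set m : A[X] → L[X] × L'[X] := fun p => (p.map φ, p.map φ') with hm
      have hP₁Γ : SignMatch (m '' (P₁ : Set A[X])) Γ :=
        hΓ.subset (Set.image_mono (by simp))
      by_cases hl : φ f.leadingCoeff = 0
      · have hl' := (hco0 f hfm _).1 hl
        refine ⟨Γ, hP₁Γ.subset ?_⟩
        rintro _ ⟨p, hp, rfl⟩
        by_cases hpf : p = f
        · subst hpf
          refine ⟨p.eraseLead, by simp [hP₁], ?_⟩
          simp only [hm]
          rw [map_eraseLead_of_leadingCoeff_eq_zero hl, map_eraseLead_of_leadingCoeff_eq_zero hl']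
        · exact ⟨p, by simp [hP₁, hpf, Finset.mem_coe.1 hp], rfl⟩
      have hl' := mt (hco0 f hfm _).2 hl
      have hΓ₁ := hP₁Γ.restrict hL' (by
        rintro _ ⟨p, hp, rfl⟩
        have := hco0 p (Finset.mem_insert_of_mem hp)
        simp only [hm, Polynomial.ext_iff, coeff_map, coeff_zero, this])
      have hsf : ∀ a ∈ Γ.filter fun a => ∃ p ∈ m '' (P₁ : Set A[X]), p.1 ≠ 0 ∧ p.1.eval a.1 = 0,
          sign ((f.map φ).eval a.1) = sign ((f.map φ').eval a.2) := by
        intro a ha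
        obtain ⟨ha, _, ⟨p, hp, rfl⟩, hp0, hpa⟩ := Finset.mem_filter.1 ha
        have hpa' : (p.map φ').eval a.2 = 0 := by
          have := hP₁Γ.sign_eval_eq a.1 a.2 (hP₁Γ.pos a ha) (m p) ⟨p, hp, rfl⟩
          rw [hpa, sign_zero] at this
          exact sign_eq_zero_iff.1 this.symm
        obtain ⟨j, hj, h1, h1', h2, h2'⟩ := exists_iterate_eraseLead φ φ' (d + 2) p
          ((card_supp_le_succ_natDegree p).trans (by have := hP₁d p hp; omega))
          (hco0 p (Finset.mem_insert_of_mem hp)) hp0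
        rw [sign_eq_of_pseudo_division (hr (eraseLead^[j] p)) h2 (by rw [h1]; exact hpa),
          sign_eq_of_pseudo_division (hr (eraseLead^[j] p)) h2' (by rw [h1']; exact hpa')]
        refine hΓ.sign_eval_eq a.1 a.2 (hΓ.pos a ha) (m (r (eraseLead^[j] p)))
          ⟨_, Finset.mem_union_right _ (Finset.mem_image.2 ⟨(p, j), ?_, rfl⟩), rfl⟩
        exact Finset.mem_product.2 ⟨hp, Finset.mem_range.2 (by omega)⟩
      have hdeg := natDegree_map_of_leadingCoeff_ne_zero φ hl
      have hdeg' := natDegree_map_of_leadingCoeff_ne_zero φ' hl'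
      obtain ⟨Γ', hΓ'⟩ := hΓ₁.exists_insert hL hL' (f := f.map φ) (f' := f.map φ')
        ⟨f.derivative, by simp [hP₁], by simp [hm, derivative_map]⟩ hsf (hdeg.trans hdeg'.symm)
        (by omega)
        (by
          rw [leadingCoeff_map_of_leadingCoeff_ne_zero φ hl,
            leadingCoeff_map_of_leadingCoeff_ne_zero φ' hl']
          exact hco f hfm _)
      refine ⟨Γ', hΓ'.subset ?_⟩
      rintro _ ⟨p, hp, rfl⟩
      by_cases hpf : p = f
      · exact Or.inl (by rw [hpf])
      · exact Or.inr ⟨p, by simp [hP₁, hpf, Finset.mem_coe.1 hp], rfl⟩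

theorem exists_sign_transfer (hL : PolyIVT L) (hL' : PolyIVT L') (P : Finset A[X]) :
    ∃ S : Finset A, ∀ (φ : A →+* L) (φ' : A →+* L'), (∀ a ∈ S, sign (φ a) = sign (φ' a)) →
      ∀ x, ∃ x', ∀ p ∈ P, sign ((p.map φ).eval x) = sign ((p.map φ').eval x') := by
  obtain ⟨S, hS⟩ := exists_signMatch hL hL' (P.sup natDegree) _ P
    (fun p hp => Finset.le_sup (f := natDegree) hp) le_rfl
  refine ⟨S, fun φ φ' h x => ?_⟩
  obtain ⟨Γ, hΓ⟩ := hS φ φ' h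
  obtain ⟨x', hx'⟩ := hΓ.exists_samePosition x
  exact ⟨x', fun p hp => hΓ.sign_eval_eq x x' hx' _ ⟨p, hp, rfl⟩⟩

theorem polyIVT_real : PolyIVT ℝ := by
  intro p a b hab h
  have hc : ContinuousOn (fun x => p.eval x) (Set.uIcc a b) := p.continuous.continuousOn
  have h0 : (0 : ℝ) ∈ Set.uIcc (p.eval a) (p.eval b) := by
    rw [Set.mem_uIcc]
    rcases mul_neg_iff.1 h with h | h
    · exact Or.inr ⟨h.2.le, h.1.le⟩
    · exact Or.inl ⟨h.1.le, h.2.le⟩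
  obtain ⟨c, hc, hc0⟩ := intermediate_value_uIcc hc h0
  rw [Set.uIcc_of_le hab.le] at hc
  refine ⟨c, hc.1.lt_of_ne ?_, hc.2.lt_of_ne ?_, hc0⟩
  · rintro rfl; simp [show p.eval a = 0 from hc0] at h
  · rintro rfl; simp [show p.eval c = 0 from hc0] at h

/-- **Artin–Lang**: sign conditions satisfied at a point over an extension of `ℝ` with the
intermediate value property are satisfied at a real point. -/
theorem exists_real_sign_transfer (hL : PolyIVT L) (n : ℕ) (φ : MvPolynomial (Fin n) ℝ →+* L)
    (S : Finset (MvPolynomial (Fin n) ℝ)) :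
    ∃ y : Fin n → ℝ, ∀ p ∈ S, sign (φ p) = sign (MvPolynomial.eval y p) := by
  classical
  induction n with
  | zero =>
    have hφ : StrictMono (φ.comp MvPolynomial.C) := by
      refine (ringHom_monotone
        (fun r hr => ⟨√r, (Real.mul_self_sqrt hr).symm⟩) _).strictMono_of_injective
        (RingHom.injective _)
    refine ⟨Fin.elim0, fun p _ => ?_⟩
    rw [MvPolynomial.eq_C_of_isEmpty p, MvPolynomial.eval_C]
    exact hφ.sign_comp _
  | succ n ih =>
    set E := MvPolynomial.finSuccEquiv ℝ n with hE
    obtain ⟨T, hT⟩ := exists_sign_transfer hL polyIVT_real (S.image E)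
    set ψ : MvPolynomial (Fin n) ℝ →+* L :=
      (φ.comp (E.symm : Polynomial (MvPolynomial (Fin n) ℝ) →+* _)).comp Polynomial.C with hψ
    obtain ⟨y, hy⟩ := ih ψ T
    obtain ⟨x', hx'⟩ := hT ψ (MvPolynomial.eval y) hy (φ (E.symm Polynomial.X))
    refine ⟨Fin.cons x' y, fun p hp => ?_⟩
    have h := hx' (E p) (Finset.mem_image_of_mem _ hp)
    rw [MvPolynomial.eval_eq_eval_mv_eval', ← h]
    congr 1
    have : φ p = (φ.comp (E.symm : Polynomial (MvPolynomial (Fin n) ℝ) →+* _)) (E p) := by simp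
    rw [this, eval_map, hψ]
    generalize E p = u
    induction u using Polynomial.induction_on' with
    | add p q hp hq => rw [map_add, hp, hq, eval₂_add]
    | monomial k a =>
      rw [eval₂_monomial, ← C_mul_X_pow_eq_monomial, map_mul, map_pow]; rfl

end Polynomial

section RealClosure

open IntermediateField

set_option linter.unusedSectionVars false

theorem exists_linearOrder_of_subsemiring {F : Type} [Field F] (P : Subsemiring F)
    (hneg : (-1 : F) ∉ P) (htot : ∀ a, a ∈ P ∨ -a ∈ P) :
    ∃ _ : LinearOrder F, IsStrictOrderedRing F ∧ ∀ x : F, 0 ≤ x ↔ x ∈ P := by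
  classical
  have hsq : ∀ a, a * a ∈ P := fun a => (htot a).elim (fun h => mul_mem h h) fun h => by
    simpa using mul_mem h h
  let C : RingCone F :=
    { P with
      eq_zero_of_mem_of_neg_mem' := by
        intro a ha hna
        by_contra h0
        refine hneg ?_
        have := P.mul_mem (P.mul_mem ha hna) (hsq a⁻¹)
        rwa [show a * -a * (a⁻¹ * a⁻¹) = -1 by field_simp] at this }
  have : HasMemOrNegMem C := ⟨htot⟩
  let _ : LinearOrder F := LinearOrder.mkOfAddGroupCone C
  have : IsOrderedRing F := IsOrderedRing.mkOfCone C
  refine ⟨inferInstance, IsOrderedRing.toIsStrictOrderedRing F, fun x => ?_⟩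
  change x - 0 ∈ C ↔ _
  rw [sub_zero]; rfl

variable {K Ω : Type} [Field K] [Field Ω] [Algebra K Ω]

/-- The preorder of `E` generated by `M`. -/
def extCone (M : Subsemiring K) (E : IntermediateField K Ω) : AddSubmonoid Ω :=
  AddSubmonoid.closure {x | ∃ m ∈ M, ∃ e ∈ E, x = algebraMap K Ω m * e ^ 2}

variable {M : Subsemiring K} {E : IntermediateField K Ω}

theorem mul_sq_mem_extCone {m : K} (hm : m ∈ M) {e : Ω} (he : e ∈ E) :
    algebraMap K Ω m * e ^ 2 ∈ extCone M E :=
  AddSubmonoid.subset_closure ⟨m, hm, e, he, rfl⟩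

theorem sq_mem_extCone {e : Ω} (he : e ∈ E) : e ^ 2 ∈ extCone M E := by
  simpa using mul_sq_mem_extCone M.one_mem he

theorem algebraMap_mem_extCone {m : K} (hm : m ∈ M) : algebraMap K Ω m ∈ extCone M E := by
  simpa using mul_sq_mem_extCone hm E.one_mem

theorem one_mem_extCone : (1 : Ω) ∈ extCone M E := by
  simpa using algebraMap_mem_extCone (E := E) M.one_mem

theorem mul_mem_extCone {x y : Ω} (hx : x ∈ extCone M E) (hy : y ∈ extCone M E) :
    x * y ∈ extCone M E := by
  induction hx using AddSubmonoid.closure_induction with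
  | zero => simp
  | add x z _ _ h1 h2 => rw [add_mul]; exact add_mem h1 h2
  | mem x hx =>
    obtain ⟨m, hm, e, he, rfl⟩ := hx
    induction hy using AddSubmonoid.closure_induction with
    | zero => simp
    | add x z _ _ h1 h2 => rw [mul_add]; exact add_mem h1 h2
    | mem x hx =>
      obtain ⟨m', hm', e', he', rfl⟩ := hx
      convert mul_sq_mem_extCone (M.mul_mem hm hm') (E.mul_mem he he') using 1
      rw [map_mul]; ring

theorem extCone_le {x : Ω} (hx : x ∈ extCone M E) : x ∈ E := by
  induction hx using AddSubmonoid.closure_induction with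
  | mem x hx =>
    obtain ⟨m, -, e, he, rfl⟩ := hx
    exact E.mul_mem (E.algebraMap_mem m) (pow_mem he 2)
  | zero => exact E.zero_mem
  | add x y _ _ h1 h2 => exact E.add_mem h1 h2

theorem inv_mem_extCone {x : Ω} (hx : x ∈ extCone M E) : x⁻¹ ∈ extCone M E := by
  by_cases h0 : x = 0
  · simp [h0]
  · have := mul_mem_extCone hx (sq_mem_extCone (M := M) (E.inv_mem (extCone_le hx)))
    rwa [show x * x⁻¹ ^ 2 = x⁻¹ by field_simp] at this

theorem extCone_mono {E' : IntermediateField K Ω} (h : E ≤ E') : extCone M E ≤ extCone M E' :=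
  AddSubmonoid.closure_mono fun _ ⟨m, hm, e, he, hx⟩ => ⟨m, hm, e, h he, hx⟩

theorem exists_maximal_extCone (hM : (-1 : K) ∉ M) (hsq : ∀ a, a * a ∈ M) :
    ∃ E : IntermediateField K Ω, Maximal (fun E => (-1 : Ω) ∉ extCone M E) E := by
  have hbot : (-1 : Ω) ∉ extCone M (⊥ : IntermediateField K Ω) := by
    intro hmem
    have key : ∀ x ∈ extCone M (⊥ : IntermediateField K Ω), ∃ m ∈ M, algebraMap K Ω m = x := by
      intro x hx
      induction hx using AddSubmonoid.closure_induction with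
      | mem x hx =>
        obtain ⟨m, hm, e, he, rfl⟩ := hx
        obtain ⟨k, rfl⟩ := mem_bot.1 he
        exact ⟨m * (k * k), M.mul_mem hm (hsq k), by simp [sq]⟩
      | zero => exact ⟨0, M.zero_mem, map_zero _⟩
      | add x y _ _ h1 h2 =>
        obtain ⟨m₁, h1, rfl⟩ := h1
        obtain ⟨m₂, h2, rfl⟩ := h2
        exact ⟨m₁ + m₂, M.add_mem h1 h2, map_add _ _ _⟩
    obtain ⟨m, hm, h⟩ := key _ hmem
    rw [← map_one (algebraMap K Ω), ← map_neg] at h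
    exact hM ((algebraMap K Ω).injective h ▸ hm)
  have hchain : ∀ c ⊆ {E : IntermediateField K Ω | (-1 : Ω) ∉ extCone M E}, IsChain (· ≤ ·) c →
      ∀ y ∈ c, ∃ ub ∈ {E : IntermediateField K Ω | (-1 : Ω) ∉ extCone M E}, ∀ z ∈ c, z ≤ ub := by
    intro c hc hchain y hy
    refine ⟨sSup c, fun hmem => ?_, fun z hz => le_sSup hz⟩
    have key : ∀ x ∈ extCone M (sSup c), ∃ E ∈ c, x ∈ extCone M E := by
      intro x hx
      induction hx using AddSubmonoid.closure_induction with
      | mem x hx =>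
        obtain ⟨m, hm, e, he, rfl⟩ := hx
        have : Nonempty c := ⟨⟨y, hy⟩⟩
        rw [sSup_eq_iSup', ← SetLike.mem_coe, coe_iSup_of_directed hchain.directed,
          Set.mem_iUnion] at he
        obtain ⟨⟨F, hF⟩, he⟩ := he
        exact ⟨F, hF, mul_sq_mem_extCone hm he⟩
      | zero => exact ⟨y, hy, zero_mem _⟩
      | add x y _ _ h1 h2 =>
        obtain ⟨E₁, h1, h1'⟩ := h1
        obtain ⟨E₂, h2, h2'⟩ := h2
        rcases hchain.total h1 h2 with h | h
        · exact ⟨E₂, h2, add_mem (extCone_mono h h1') h2'⟩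
        · exact ⟨E₁, h1, add_mem h1' (extCone_mono h h2')⟩
    obtain ⟨E, hE, hE'⟩ := key _ hmem
    exact hc hE hE'
  obtain ⟨E, -, hE⟩ := zorn_le_nonempty₀ _ hchain ⊥ hbot
  exact ⟨E, hE⟩

end RealClosure

section RealClosure

open IntermediateField

theorem Polynomial.exists_isSumSq_natDegree_le {L : Type} [Field L] {f s : Polynomial L}
    (hf : 0 < f.natDegree) (hs : IsSumSq s) :
    ∃ s', IsSumSq s' ∧ f ∣ s - s' ∧ s'.natDegree ≤ 2 * (f.natDegree - 1) := by
  induction hs with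
  | zero => exact ⟨0, .zero, by simp, by simp⟩
  | sq_add a _ ih =>
    obtain ⟨s', h1, h2, h3⟩ := ih
    refine ⟨(a % f) * (a % f) + s', .sq_add _ h1, ?_, ?_⟩
    · have h4 : f ∣ a - a % f := by
        have := EuclideanDomain.div_add_mod a f
        exact ⟨a / f, by linear_combination -this⟩
      obtain ⟨u, hu⟩ := h4
      obtain ⟨v, hv⟩ := h2
      exact ⟨u * (a + a % f) + v, by linear_combination (a + a % f) * hu + hv⟩
    · have h5 := natDegree_mod_lt a hf.ne'
      refine (natDegree_add_le _ _).trans (max_le (natDegree_mul_le.trans (by omega)) h3)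

theorem Polynomial.not_dvd_one_add_of_eval_mul_neg {L : Type} [Field L] [LinearOrder L]
    [IsStrictOrderedRing L] {f s : Polynomial L} {a b : L} (h : f.eval a * f.eval b < 0)
    (hs : IsSumSq s) : ¬ f ∣ 1 + s := by
  induction hn : f.natDegree using Nat.strong_induction_on generalizing f s with
  | _ n ih =>
    intro hdvd
    have hf : 0 < f.natDegree := by
      by_contra h0
      rw [eq_C_of_natDegree_le_zero (not_lt.1 h0)] at h
      simp only [eval_C] at h
      exact absurd h (not_lt.2 (mul_self_nonneg _))
    obtain ⟨s', h1, h2, h3⟩ := exists_isSumSq_natDegree_le hf hs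
    obtain ⟨g, hg⟩ : f ∣ 1 + s' := by
      have := dvd_sub hdvd h2
      rwa [show 1 + s - (s - s') = 1 + s' by ring] at this
    have hpos : ∀ x, 0 < f.eval x * g.eval x := by
      intro x
      rw [← eval_mul, ← hg, eval_add, eval_one]
      have : 0 ≤ s'.eval x := by
        clear h2 h3 hg
        induction h1 with
        | zero => simp
        | sq_add a _ ih =>
          rw [eval_add, eval_mul]
          exact add_nonneg (mul_self_nonneg _) ih
      linarith
    have hg0 : g ≠ 0 := by
      rintro rfl
      simpa using hpos a
    have hf0 : f ≠ 0 := by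
      rintro rfl
      simp at hf
    refine ih g.natDegree ?_ (f := g) ?_ h1 rfl ⟨f, by rw [hg, mul_comm]⟩
    · have h4 : (f * g).natDegree ≤ 2 * (f.natDegree - 1) := by
        rw [← hg]
        exact (natDegree_add_le _ _).trans (max_le (by simp) h3)
      rw [natDegree_mul hf0 hg0] at h4
      omega
    · have := mul_pos (hpos a) (hpos b)
      rw [show f.eval a * g.eval a * (f.eval b * g.eval b) =
        (-(f.eval a * f.eval b)) * -(g.eval a * g.eval b) by ring] at this
      have := (pos_iff_pos_of_mul_pos this).1 (neg_pos.2 h)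
      exact neg_pos.1 this

theorem Polynomial.exists_irreducible_eval_mul_neg {L : Type} [Field L] [LinearOrder L]
    [IsStrictOrderedRing L] {a b : L} (f : Polynomial L) (h : f.eval a * f.eval b < 0) :
    ∃ q, Irreducible q ∧ q ∣ f ∧ q.eval a * q.eval b < 0 := by
  induction f using WfDvdMonoid.induction_on_irreducible with
  | zero => simp at h
  | unit u hu =>
    obtain ⟨c, -, rfl⟩ := Polynomial.isUnit_iff.1 hu
    simp only [eval_C] at h
    exact absurd h (not_lt.2 (mul_self_nonneg _))
  | mul p q hp hq ih =>
    by_cases hneg : q.eval a * q.eval b < 0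
    · exact ⟨q, hq, dvd_mul_right _ _, hneg⟩
    · obtain ⟨r, h1, h2, h3⟩ := ih (by
        rw [eval_mul, eval_mul] at h
        by_contra h0
        have := mul_nonneg (not_lt.1 h0) (not_lt.1 hneg)
        refine absurd h (not_lt.2 ?_)
        linarith)
      exact ⟨r, h1, h2.mul_left _, h3⟩

variable {K Ω : Type} [Field K] [Field Ω] [Algebra K Ω] {M : Subsemiring K}
  {E : IntermediateField K Ω}

theorem IntermediateField.exists_adjoin_eq_aeval [Algebra.IsAlgebraic K Ω]
    (E : IntermediateField K Ω) (θ : Ω) :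
    ∃ E' : IntermediateField K Ω, E ≤ E' ∧ θ ∈ E' ∧
      ∀ x ∈ E', ∃ h : Polynomial E, x = Polynomial.aeval θ h := by
  refine ⟨(adjoin E {θ}).restrictScalars K, fun x hx => ?_, ?_, fun x hx => ?_⟩
  · rw [mem_restrictScalars]
    exact (adjoin E {θ}).algebraMap_mem ⟨x, hx⟩
  · rw [mem_restrictScalars]
    exact mem_adjoin_simple_self E θ
  · rw [mem_restrictScalars, ← mem_toSubalgebra, adjoin_simple_toSubalgebra_of_isAlgebraic
      ((Algebra.IsAlgebraic.tower_top (K := K) E).isAlgebraic θ),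
      Algebra.adjoin_singleton_eq_range_aeval] at hx
    obtain ⟨h, rfl⟩ := hx
    exact ⟨h, rfl⟩

theorem exists_of_sq_mem [Algebra.IsAlgebraic K Ω]
    (hE : Maximal (fun E => (-1 : Ω) ∉ extCone M E) E) {a θ : Ω} (ha : a ∈ E) (hθ : θ ^ 2 = a) :
    θ ∈ E ∨ ∃ α ∈ extCone M E, ∃ β ∈ extCone M E, -1 = α + a * β := by
  obtain ⟨E', hEE', hθE', hE'⟩ := E.exists_adjoin_eq_aeval θ
  by_cases hmem : (-1 : Ω) ∈ extCone M E'
  swap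
  · exact Or.inl (hE.2 hmem hEE' hθE')
  rw [or_iff_not_imp_left]
  intro hθE
  have hlin : ∀ h : Polynomial E, ∃ u ∈ E, ∃ v ∈ E, Polynomial.aeval θ h = u + v * θ := by
    intro h
    induction h using Polynomial.induction_on' with
    | add p q hp hq =>
      obtain ⟨u, hu, v, hv, h1⟩ := hp
      obtain ⟨u', hu', v', hv', h2⟩ := hq
      exact ⟨u + u', E.add_mem hu hu', v + v', E.add_mem hv hv', by rw [map_add, h1, h2]; ring⟩
    | monomial k c =>
      rw [Polynomial.aeval_monomial]
      change ∃ u ∈ E, ∃ v ∈ E, (c : Ω) * θ ^ k = u + v * θ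
      rcases k.even_or_odd' with ⟨j, rfl | rfl⟩
      · exact ⟨c * a ^ j, E.mul_mem c.2 (pow_mem ha j), 0, E.zero_mem, by
          rw [pow_mul, hθ]; ring⟩
      · exact ⟨0, E.zero_mem, c * a ^ j, E.mul_mem c.2 (pow_mem ha j), by
          rw [pow_succ, pow_mul, hθ]; ring⟩
  have key : ∀ x ∈ extCone M E', ∃ α ∈ extCone M E, ∃ β ∈ extCone M E, ∃ γ ∈ E,
      x = α + a * β + γ * θ := by
    intro x hx
    induction hx using AddSubmonoid.closure_induction with
    | mem x hx =>
      obtain ⟨m, hm, e, he, rfl⟩ := hx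
      obtain ⟨h, rfl⟩ := hE' e he
      obtain ⟨u, hu, v, hv, h1⟩ := hlin h
      refine ⟨_, mul_sq_mem_extCone hm hu, _, mul_sq_mem_extCone hm hv,
        algebraMap K Ω m * (2 * u * v),
        E.mul_mem (E.algebraMap_mem m) (E.mul_mem (E.mul_mem (ofNat_mem E 2) hu) hv), ?_⟩
      rw [h1, ← hθ]; ring
    | zero => exact ⟨0, zero_mem _, 0, zero_mem _, 0, E.zero_mem, by simp⟩
    | add x y _ _ h1 h2 =>
      obtain ⟨α, hα, β, hβ, γ, hγ, rfl⟩ := h1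
      obtain ⟨α', hα', β', hβ', γ', hγ', rfl⟩ := h2
      exact ⟨_, add_mem hα hα', _, add_mem hβ hβ', _, E.add_mem hγ hγ', by ring⟩
  obtain ⟨α, hα, β, hβ, γ, hγ, h⟩ := key _ hmem
  by_cases hγ0 : γ = 0
  · exact ⟨α, hα, β, hβ, by rw [h, hγ0]; ring⟩
  · refine absurd ?_ hθE
    have h1 : θ = (-1 - α - a * β) / γ := by rw [h]; field_simp; ring
    rw [h1]
    exact E.div_mem (E.sub_mem (E.sub_mem (E.neg_mem E.one_mem) (extCone_le hα))
      (E.mul_mem ha (extCone_le hβ))) hγ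

theorem mem_extCone_iff [Algebra.IsAlgebraic K Ω] [IsAlgClosed Ω]
    (hE : Maximal (fun E => (-1 : Ω) ∉ extCone M E) E) {a : Ω} :
    a ∈ extCone M E ↔ ∃ e ∈ E, a = e ^ 2 := by
  refine ⟨fun ha => ?_, fun ⟨e, he, h⟩ => h ▸ sq_mem_extCone he⟩
  obtain ⟨θ, hθ⟩ := IsAlgClosed.exists_pow_nat_eq a two_pos
  rcases exists_of_sq_mem hE (extCone_le ha) hθ with h | ⟨α, hα, β, hβ, h⟩
  · exact ⟨θ, h, hθ.symm⟩
  · exact absurd (h ▸ add_mem hα (mul_mem_extCone ha hβ)) hE.1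

theorem mem_extCone_or_neg_mem [Algebra.IsAlgebraic K Ω] [IsAlgClosed Ω]
    (hE : Maximal (fun E => (-1 : Ω) ∉ extCone M E) E) {a : Ω} (ha : a ∈ E) :
    a ∈ extCone M E ∨ -a ∈ extCone M E := by
  obtain ⟨θ, hθ⟩ := IsAlgClosed.exists_pow_nat_eq a two_pos
  rcases exists_of_sq_mem hE ha hθ with h | ⟨α, hα, β, hβ, h⟩
  · exact Or.inl (hθ ▸ sq_mem_extCone h)
  · right
    have hβ0 : β ≠ 0 := by
      rintro rfl
      rw [mul_zero, add_zero] at h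
      exact hE.1 (h ▸ hα)
    rw [show -a = (1 + α) * β⁻¹ by field_simp; linear_combination h]
    exact mul_mem_extCone (add_mem one_mem_extCone hα) (inv_mem_extCone hβ)

theorem exists_dvd_one_add_isSumSq [Algebra.IsAlgebraic K Ω] [IsAlgClosed Ω]
    (hE : Maximal (fun E => (-1 : Ω) ∉ extCone M E) E) {q : Polynomial E} (hq : Irreducible q)
    (hroot : ∀ x, q.eval x ≠ 0) : ∃ s, IsSumSq s ∧ q ∣ 1 + s := by
  obtain ⟨θ, hθ⟩ := IsAlgClosed.exists_aeval_eq_zero Ω q hq.degree_pos.ne'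
  have hθE : θ ∉ E := fun h => by
    refine hroot ⟨θ, h⟩ ((algebraMap E Ω).injective ?_)
    rw [map_zero, ← hθ, Polynomial.aeval_def, ← Polynomial.eval₂_at_apply]; rfl
  obtain ⟨E', hEE', hθE', hE'⟩ := E.exists_adjoin_eq_aeval θ
  have hmem : (-1 : Ω) ∈ extCone M E' := by
    by_contra hmem
    exact hθE (hE.2 hmem hEE' hθE')
  have key : ∀ x ∈ extCone M E', ∃ s : Polynomial E, IsSumSq s ∧ x = Polynomial.aeval θ s := by
    intro x hx
    induction hx using AddSubmonoid.closure_induction with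
    | mem x hx =>
      obtain ⟨m, hm, e, he, rfl⟩ := hx
      obtain ⟨h, rfl⟩ := hE' e he
      obtain ⟨u, hu, h1⟩ := (mem_extCone_iff hE).1 (algebraMap_mem_extCone hm)
      refine ⟨Polynomial.C ⟨u, hu⟩ * h * (Polynomial.C ⟨u, hu⟩ * h), IsSumSq.mul_self _, ?_⟩
      rw [h1, map_mul, map_mul, Polynomial.aeval_C]
      change _ = u * _ * (u * _)
      ring
    | zero => exact ⟨0, .zero, by simp⟩
    | add x y _ _ h1 h2 =>
      obtain ⟨s, hs, rfl⟩ := h1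
      obtain ⟨t, ht, rfl⟩ := h2
      exact ⟨s + t, hs.add ht, by simp⟩
  obtain ⟨s, hs, h⟩ := key _ hmem
  refine ⟨s, hs, ?_⟩
  by_contra hdvd
  obtain ⟨u, v, huv⟩ := (hq.coprime_iff_not_dvd).2 hdvd
  have := congrArg (Polynomial.aeval θ) huv
  simp [hθ, ← h] at this

/-- A field with a preorder maps to an ordered field with the intermediate value property, such
that the elements of the preorder become nonnegative. -/
theorem exists_polyIVT_of_subsemiring {K : Type} [Field K] (M : Subsemiring K)
    (hM : (-1 : K) ∉ M) (hsq : ∀ a, a * a ∈ M) :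
    ∃ (L : Type) (_ : Field L) (_ : LinearOrder L), IsStrictOrderedRing L ∧
      Polynomial.PolyIVT L ∧ ∃ φ : K →+* L, ∀ m ∈ M, 0 ≤ φ m := by
  obtain ⟨E, hE⟩ := exists_maximal_extCone (Ω := AlgebraicClosure K) hM hsq
  let P : Subsemiring E :=
    { carrier := {x | (x : AlgebraicClosure K) ∈ extCone M E}
      mul_mem' := fun ha hb => mul_mem_extCone ha hb
      one_mem' := one_mem_extCone
      add_mem' := fun ha hb => (extCone M E).add_mem ha hb
      zero_mem' := (extCone M E).zero_mem }
  obtain ⟨ord, hord, hP⟩ := exists_linearOrder_of_subsemiring P (by exact hE.1)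
    fun a => mem_extCone_or_neg_mem hE a.2
  refine ⟨E, inferInstance, ord, hord, fun p a b hab h => ?_, algebraMap K E, fun m hm => ?_⟩
  · obtain ⟨q, hq, ⟨r, rfl⟩, hneg⟩ := Polynomial.exists_irreducible_eval_mul_neg p h
    by_cases hroot : ∀ x, q.eval x ≠ 0
    · obtain ⟨s, hs, hdvd⟩ := exists_dvd_one_add_isSumSq hE hq hroot
      exact absurd hdvd (Polynomial.not_dvd_one_add_of_eval_mul_neg hneg hs)
    · push Not at hroot
      obtain ⟨c, hc⟩ := hroot
      obtain ⟨u, rfl⟩ := Polynomial.dvd_iff_isRoot.2 hc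
      have hu : u.natDegree = 0 := Polynomial.natDegree_eq_zero_of_isUnit
        ((of_irreducible_mul hq).resolve_left (Polynomial.not_isUnit_X_sub_C c))
      obtain ⟨k, rfl⟩ := Polynomial.natDegree_eq_zero.1 hu
      simp only [Polynomial.eval_mul, Polynomial.eval_sub, Polynomial.eval_X,
        Polynomial.eval_C] at hneg
      have h1 : (a - c) * (b - c) < 0 := by
        by_contra h0
        have := mul_nonneg (not_lt.1 h0) (mul_self_nonneg k)
        refine absurd hneg (not_lt.2 ?_)
        linarith
      refine ⟨c, ?_, ?_, by simp⟩ <;> by_contra h2 <;> nlinarith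
  · exact (hP _).2 (algebraMap_mem_extCone hm)

end RealClosure

section RingPreorder

variable {A : Type} [CommRing A] {M : Subsemiring A}

theorem Subsemiring.exists_maximal_neg_one_notMem (T : Subsemiring A) (hT : (-1 : A) ∉ T) :
    ∃ M, T ≤ M ∧ Maximal (fun M : Subsemiring A => (-1 : A) ∉ M) M := by
  have hchain : ∀ c ⊆ {M : Subsemiring A | (-1 : A) ∉ M}, IsChain (· ≤ ·) c →
      ∀ y ∈ c, ∃ ub ∈ {M : Subsemiring A | (-1 : A) ∉ M}, ∀ z ∈ c, z ≤ ub := by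
    intro c hc hchain y hy
    refine ⟨sSup c, fun hmem => ?_, fun z hz => le_sSup hz⟩
    obtain ⟨M, hM, h⟩ := (Subsemiring.mem_sSup_of_directedOn ⟨y, hy⟩ hchain.directedOn).1 hmem
    exact hc hM h
  obtain ⟨M, hTM, hM⟩ := zorn_le_nonempty₀ _ hchain T hT
  exact ⟨M, hTM, hM⟩

/-- For a subsemiring `M` containing all squares, the subsemiring `M + M * a`. -/
def Subsemiring.extendBy (M : Subsemiring A) (hsq : ∀ a : A, a * a ∈ M) (a : A) :
    Subsemiring A where
  carrier := {x | ∃ s ∈ M, ∃ t ∈ M, x = s + t * a}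
  zero_mem' := ⟨0, M.zero_mem, 0, M.zero_mem, by ring⟩
  one_mem' := ⟨1, M.one_mem, 0, M.zero_mem, by ring⟩
  add_mem' := by
    rintro _ _ ⟨s, hs, t, ht, rfl⟩ ⟨s', hs', t', ht', rfl⟩
    exact ⟨s + s', M.add_mem hs hs', t + t', M.add_mem ht ht', by ring⟩
  mul_mem' := by
    rintro _ _ ⟨s, hs, t, ht, rfl⟩ ⟨s', hs', t', ht', rfl⟩
    exact ⟨s * s' + t * t' * (a * a),
      M.add_mem (M.mul_mem hs hs') (M.mul_mem (M.mul_mem ht ht') (hsq a)), s * t' + s' * t,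
      M.add_mem (M.mul_mem hs ht') (M.mul_mem hs' ht), by ring⟩

theorem Subsemiring.le_extendBy (M : Subsemiring A) (hsq : ∀ a : A, a * a ∈ M) (a : A) :
    M ≤ M.extendBy hsq a :=
  fun x hx => ⟨x, hx, 0, M.zero_mem, by ring⟩

theorem Subsemiring.mem_extendBy (M : Subsemiring A) (hsq : ∀ a : A, a * a ∈ M) (a : A) :
    a ∈ M.extendBy hsq a :=
  ⟨0, M.zero_mem, 1, M.one_mem, by ring⟩

theorem Subsemiring.exists_of_notMem_maximal (hsq : ∀ a : A, a * a ∈ M)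
    (hM : Maximal (fun M : Subsemiring A => (-1 : A) ∉ M) M) {a : A} (ha : a ∉ M) :
    ∃ s ∈ M, ∃ t ∈ M, -1 = s + t * a := by
  by_contra hcon
  refine ha (hM.2 (y := M.extendBy hsq a) (fun h => hcon h) (M.le_extendBy hsq a)
    (M.mem_extendBy hsq a))

theorem Subsemiring.mem_or_neg_mem_of_maximal (hsq : ∀ a : A, a * a ∈ M)
    (hM : Maximal (fun M : Subsemiring A => (-1 : A) ∉ M) M) (a : A) : a ∈ M ∨ -a ∈ M := by
  by_contra! h
  obtain ⟨s, hs, t, ht, h1⟩ := exists_of_notMem_maximal hsq hM h.1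
  obtain ⟨u, hu, v, hv, h2⟩ := exists_of_notMem_maximal hsq hM h.2
  refine hM.1 ?_
  rw [show (-1 : A) = s + u + s * u + t * v * (a * a) by
    linear_combination (1 + u) * h1 - t * a * h2]
  exact M.add_mem (M.add_mem (M.add_mem hs hu) (M.mul_mem hs hu))
    (M.mul_mem (M.mul_mem ht hv) (hsq a))

theorem Subsemiring.exists_isPrime_of_maximal (hsq : ∀ a : A, a * a ∈ M)
    (hM : Maximal (fun M : Subsemiring A => (-1 : A) ∉ M) M) :
    ∃ I : Ideal A, I.IsPrime ∧ ∀ a, a ∈ I ↔ a ∈ M ∧ -a ∈ M := by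
  let I : Ideal A :=
    { carrier := {a | a ∈ M ∧ -a ∈ M}
      zero_mem' := ⟨M.zero_mem, by simp⟩
      add_mem' := fun {a b} ha hb => ⟨M.add_mem ha.1 hb.1, by
        rw [neg_add]; exact M.add_mem ha.2 hb.2⟩
      smul_mem' := fun c a ha => by
        rcases mem_or_neg_mem_of_maximal hsq hM c with hc | hc
        · exact ⟨M.mul_mem hc ha.1, by simpa using M.mul_mem hc ha.2⟩
        · exact ⟨by simpa using M.mul_mem hc ha.2, by simpa using M.mul_mem hc ha.1⟩ }
  have key : ∀ a b, a ∉ M → b ∉ M → a * b ∉ I := by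
    intro a b ha hb hab
    obtain ⟨s, hs, t, ht, h1⟩ := exists_of_notMem_maximal hsq hM ha
    obtain ⟨u, hu, v, hv, h2⟩ := exists_of_notMem_maximal hsq hM hb
    have h3 : -(t * v * (a * b)) ∈ M := by
      simpa using M.mul_mem (M.mul_mem ht hv) hab.2
    refine hM.1 ?_
    rw [show (-1 : A) = s + u + s * u + -(t * v * (a * b)) by
      linear_combination (1 + u) * h1 - t * a * h2]
    exact M.add_mem (M.add_mem (M.add_mem hs hu) (M.mul_mem hs hu)) h3
  refine ⟨I, Ideal.isPrime_iff.2 ⟨?_, fun {a b} hab => ?_⟩, fun a => Iff.rfl⟩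
  · rw [Ideal.ne_top_iff_one]
    exact fun h => hM.1 h.2
  · by_contra! h
    have h1 : ∀ c, c ∉ I → c ∉ M ∨ -c ∉ M := fun c hc => by
      by_contra! h2
      exact hc h2
    have h2 := (I.neg_mem_iff).2 hab
    rcases h1 a h.1 with ha | ha <;> rcases h1 b h.2 with hb | hb
    · exact key _ _ ha hb hab
    · exact key _ _ ha hb (by simpa using h2)
    · exact key _ _ ha hb (by simpa using h2)
    · exact key _ _ ha hb (by simpa using hab)

/-- A proper preorder of a commutative ring is nonnegative at some point over an ordered field
with the intermediate value property. -/
theorem Subsemiring.exists_polyIVT_point (T : Subsemiring A) (hsq : ∀ a : A, a * a ∈ T)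
    (hT : (-1 : A) ∉ T) :
    ∃ (L : Type) (_ : Field L) (_ : LinearOrder L), IsStrictOrderedRing L ∧
      Polynomial.PolyIVT L ∧ ∃ φ : A →+* L, ∀ t ∈ T, 0 ≤ φ t := by
  obtain ⟨M, hTM, hM⟩ := T.exists_maximal_neg_one_notMem hT
  replace hsq : ∀ a : A, a * a ∈ M := fun a => hTM (hsq a)
  obtain ⟨I, hI, hIM⟩ := exists_isPrime_of_maximal hsq hM
  let ι : A →+* FractionRing (A ⧸ I) := (algebraMap (A ⧸ I) _).comp (Ideal.Quotient.mk I)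
  have hι : ∀ a, ι a = 0 ↔ a ∈ I := fun a => by
    rw [← Ideal.Quotient.eq_zero_iff_mem]
    exact FaithfulSMul.algebraMap_eq_zero_iff (A ⧸ I) (FractionRing (A ⧸ I))
  have hdiv : ∀ x : FractionRing (A ⧸ I), ∃ a d, ι d ≠ 0 ∧ x * ι d = ι a := by
    intro x
    obtain ⟨a, d, hd, rfl⟩ := IsFractionRing.div_surjective (A := A ⧸ I) x
    obtain ⟨a, rfl⟩ := Ideal.Quotient.mk_surjective a
    obtain ⟨d, rfl⟩ := Ideal.Quotient.mk_surjective d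
    have hd0 : ι d ≠ 0 := IsFractionRing.to_map_ne_zero_of_mem_nonZeroDivisors
      (R := A ⧸ I) (K := FractionRing (A ⧸ I)) hd
    exact ⟨a, d, hd0, div_mul_cancel₀ _ hd0⟩
  let P : Subsemiring (FractionRing (A ⧸ I)) :=
    { carrier := {x | ∃ m ∈ M, ∃ d, ι d ≠ 0 ∧ x * ι d ^ 2 = ι m}
      zero_mem' := ⟨0, M.zero_mem, 1, by simp, by simp⟩
      one_mem' := ⟨1, M.one_mem, 1, by simp, by simp⟩
      add_mem' := by
        rintro x y ⟨m, hm, d, hd, h⟩ ⟨m', hm', d', hd', h'⟩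
        refine ⟨m * (d' * d') + m' * (d * d), M.add_mem (M.mul_mem hm (hsq _))
          (M.mul_mem hm' (hsq _)), d * d', by simp [hd, hd'], ?_⟩
        simp only [map_mul, map_add]
        linear_combination ι d' ^ 2 * h + ι d ^ 2 * h'
      mul_mem' := by
        rintro x y ⟨m, hm, d, hd, h⟩ ⟨m', hm', d', hd', h'⟩
        refine ⟨m * m', M.mul_mem hm hm', d * d', by simp [hd, hd'], ?_⟩
        simp only [map_mul]
        linear_combination y * ι d' ^ 2 * h + ι m * h' }
  obtain ⟨L, _, _, hL, hIVT, φ, hφ⟩ := exists_polyIVT_of_subsemiring P (by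
    rintro ⟨m, hm, d, hd, h⟩
    have h1 : ι (d * d + m) = 0 := by
      rw [map_add, map_mul, ← h]; ring
    rw [hι, hIM] at h1
    have h2 : -(d * d) ∈ M := by
      have := M.add_mem h1.2 hm
      rwa [show -(d * d + m) + m = -(d * d) by ring] at this
    have h3 : d * d ∈ I := (hIM _).2 ⟨hsq d, h2⟩
    exact hd ((hι d).2 ((hI.mem_or_mem h3).elim id id)))
    (by
      intro x
      obtain ⟨a, d, hd, h⟩ := hdiv x
      refine ⟨a * a, hsq a, d, hd, ?_⟩
      rw [map_mul]
      linear_combination (x * ι d + ι a) * h)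
  refine ⟨L, _, _, hL, hIVT, φ.comp ι, fun t ht => hφ _ ⟨t, hTM ht, 1, by simp, by simp⟩⟩

end RingPreorder

/-- A quadratic module of a commutative ring. -/
structure IsQuadraticModule {A : Type*} [CommRing A] (M : AddSubmonoid A) : Prop where
  one_mem : 1 ∈ M
  mul_self_mul_mem : ∀ a, ∀ x ∈ M, a * a * x ∈ M

namespace IsQuadraticModule

theorem of_subsemiring {A : Type*} [CommRing A] {T : Subsemiring A} (hsq : ∀ a : A, a * a ∈ T) :
    IsQuadraticModule T.toAddSubmonoid :=
  ⟨T.one_mem, fun a _ hx => T.mul_mem (hsq a) hx⟩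

section CommRing

variable {A : Type*} [CommRing A] {M : AddSubmonoid A}

theorem mul_self_mem (hM : IsQuadraticModule M) (a : A) : a * a ∈ M := by
  simpa using hM.mul_self_mul_mem a 1 hM.one_mem

theorem isSumSq_mul_mem (hM : IsQuadraticModule M) {σ : A} (hσ : IsSumSq σ) {x : A}
    (hx : x ∈ M) : σ * x ∈ M := by
  induction hσ with
  | zero => simp
  | sq_add a _ ih =>
    rw [add_mul]
    exact M.add_mem (hM.mul_self_mul_mem a x hx) ih

theorem isSumSq_mem (hM : IsQuadraticModule M) {σ : A} (hσ : IsSumSq σ) : σ ∈ M := by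
  simpa using hM.isSumSq_mul_mem hσ hM.one_mem

end CommRing

section MvPolynomial

variable {n : ℕ} {M : AddSubmonoid (MvPolynomial (Fin n) ℝ)}

theorem C_mul_mem (hM : IsQuadraticModule M) {r : ℝ} (hr : 0 ≤ r)
    {x : MvPolynomial (Fin n) ℝ} (hx : x ∈ M) :
    C r * x ∈ M := by
  have := hM.mul_self_mul_mem (C √r) x hx
  rwa [← C_mul, Real.mul_self_sqrt hr] at this

theorem C_mem (hM : IsQuadraticModule M) {r : ℝ} (hr : 0 ≤ r) : C r ∈ M := by
  simpa using hM.C_mul_mem hr hM.one_mem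

theorem mem_of_C_mul_mem (hM : IsQuadraticModule M) {r : ℝ} (hr : 0 < r)
    {x : MvPolynomial (Fin n) ℝ} (hx : C r * x ∈ M) :
    x ∈ M := by
  have := hM.C_mul_mem (inv_nonneg.2 hr.le) hx
  rwa [← mul_assoc, ← C_mul, inv_mul_cancel₀ hr.ne', C_1, one_mul] at this

/-- If a quadratic module contains `N - ∑ Xᵢ²` then it is Archimedean. -/
theorem exists_C_sub_mem (hM : IsQuadraticModule M) {N : ℝ}
    (hN : C N - ∑ i, X i ^ 2 ∈ M) (p : MvPolynomial (Fin n) ℝ) :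
    ∃ r : ℝ, 0 < r ∧ C r - p ∈ M ∧ C r + p ∈ M := by
  have hadd : ∀ p q : MvPolynomial (Fin n) ℝ, (∃ r : ℝ, 0 < r ∧ C r - p ∈ M ∧ C r + p ∈ M) →
      (∃ r : ℝ, 0 < r ∧ C r - q ∈ M ∧ C r + q ∈ M) →
      ∃ r : ℝ, 0 < r ∧ C r - (p + q) ∈ M ∧ C r + (p + q) ∈ M := by
    rintro p q ⟨r, hr, h1, h2⟩ ⟨s, hs, h3, h4⟩
    refine ⟨r + s, by positivity, ?_, ?_⟩
    · convert M.add_mem h1 h3 using 1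
      rw [C_add]; ring
    · convert M.add_mem h2 h4 using 1
      rw [C_add]; ring
  have hneg : ∀ p : MvPolynomial (Fin n) ℝ, (∃ r : ℝ, 0 < r ∧ C r - p ∈ M ∧ C r + p ∈ M) →
      ∃ r : ℝ, 0 < r ∧ C r - (-p) ∈ M ∧ C r + (-p) ∈ M := by
    rintro p ⟨r, hr, h1, h2⟩
    exact ⟨r, hr, by simpa using h2, by simpa [sub_eq_add_neg] using h1⟩
  have hsq : ∀ p : MvPolynomial (Fin n) ℝ, (∃ r : ℝ, 0 < r ∧ C r - p ∈ M ∧ C r + p ∈ M) →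
      ∃ r : ℝ, 0 < r ∧ C r - C (1 / 4) * p ^ 2 ∈ M ∧ C r + C (1 / 4) * p ^ 2 ∈ M := by
    rintro p ⟨r, hr, h1, h2⟩
    refine ⟨r ^ 2 / 4, by positivity, ?_, ?_⟩
    · refine hM.mem_of_C_mul_mem (r := 8 * r) (by positivity) ?_
      have h4 := hM.mul_self_mul_mem (C r + p) _ h1
      have h5 := hM.mul_self_mul_mem (C r - p) _ h2
      convert M.add_mem h4 h5 using 1
      have e1 : (C (8 * r) * C (r ^ 2 / 4) : MvPolynomial (Fin n) ℝ) = 2 * C r ^ 3 := by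
        rw [← C_mul, ← C_pow, show 8 * r * (r ^ 2 / 4) = 2 * r ^ 3 by ring, C_mul, map_ofNat C 2]
      have e2 : (C (8 * r) * C (1 / 4) : MvPolynomial (Fin n) ℝ) = 2 * C r := by
        rw [← C_mul, show 8 * r * (1 / 4) = 2 * r by ring, C_mul, map_ofNat C 2]
      linear_combination e1 - p ^ 2 * e2
    · refine M.add_mem (hM.C_mem (by positivity)) (hM.C_mul_mem (by positivity) ?_)
      rw [sq]
      exact hM.mul_self_mem p
  have h14 : (C (1 / 4) : MvPolynomial (Fin n) ℝ) * 4 = 1 := by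
    rw [show (4 : MvPolynomial (Fin n) ℝ) = C 4 from (map_ofNat C 4).symm, ← C_mul]
    norm_num
  induction p using MvPolynomial.induction_on with
  | C a =>
    refine ⟨|a| + 1, by positivity, ?_, ?_⟩
    · rw [← C_sub]
      exact hM.C_mem (by linarith [le_abs_self a])
    · rw [← C_add]
      exact hM.C_mem (by linarith [neg_abs_le a])
  | add p q hp hq => exact hadd p q hp hq
  | mul_X p i hp =>
    have hX : ∃ r : ℝ, 0 < r ∧ C r - X i ∈ M ∧ C r + X i ∈ M := by
      have h1 : C N - X i ^ 2 ∈ M := by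
        have : (C N - X i ^ 2 : MvPolynomial (Fin n) ℝ)
            = (C N - ∑ i, X i ^ 2) + ∑ j ∈ Finset.univ.erase i, X j * X j := by
          rw [← Finset.add_sum_erase _ _ (Finset.mem_univ i)]
          simp only [sq]
          ring
        rw [this]
        exact M.add_mem hN (M.sum_mem fun j _ => hM.mul_self_mem _)
      have h2 : C |N| - X i ^ 2 ∈ M := by
        have := M.add_mem h1 (hM.C_mem (r := |N| - N) (by linarith [le_abs_self N]))
        rw [C_sub] at this
        convert this using 1
        ring
      have e : (C (|N| + 1 / 4) : MvPolynomial (Fin n) ℝ) = C |N| + C (1 / 2) * C (1 / 2) := by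
        rw [← C_mul, ← C_add]; norm_num
      have e' : (C (1 / 2) : MvPolynomial (Fin n) ℝ) * 2 = 1 := by
        rw [show (2 : MvPolynomial (Fin n) ℝ) = C 2 from (map_ofNat C 2).symm, ← C_mul]
        norm_num
      refine ⟨|N| + 1 / 4, by positivity, ?_, ?_⟩
      · convert M.add_mem h2 (hM.mul_self_mem (X i - C (1 / 2))) using 1
        linear_combination e + X i * e'
      · convert M.add_mem h2 (hM.mul_self_mem (X i + C (1 / 2))) using 1
        linear_combination e - X i * e'
    have h := hadd _ _ (hsq _ (hadd _ _ hp hX)) (hneg _ (hsq _ (hadd _ _ hp (hneg _ hX))))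
    have e : C (1 / 4) * (p + X i) ^ 2 + -(C (1 / 4) * (p + -X i) ^ 2) = p * X i := by
      linear_combination p * X i * h14
    rwa [e] at h

end MvPolynomial

end IsQuadraticModule

/-- A preorder of the real polynomial ring that is nonnegative at no real point is improper. -/
theorem Subsemiring.neg_one_mem_of_forall_exists_eval_neg {n : ℕ}
    {T : Subsemiring (MvPolynomial (Fin n) ℝ)} (hsq : ∀ a, a * a ∈ T)
    {S : Finset (MvPolynomial (Fin n) ℝ)} (hST : ∀ p ∈ S, p ∈ T)
    (hS : ∀ y, ∃ p ∈ S, eval y p < 0) : -1 ∈ T := by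
  by_contra hT
  obtain ⟨L, _, _, hL, hIVT, φ, hφ⟩ := T.exists_polyIVT_point hsq hT
  obtain ⟨y, hy⟩ := Polynomial.exists_real_sign_transfer hIVT n φ S
  obtain ⟨p, hp, hneg⟩ := hS y
  have h := hy p hp
  rw [sign_neg hneg, sign_eq_neg_one_iff] at h
  exact absurd (hφ p (hST p hp)) (not_le.2 h)

/-- **Wörmann's trick**: a preorder of the real polynomial ring that contains an element whose
nonnegativity set is bounded contains some `N - ∑ Xᵢ²`. -/
theorem Subsemiring.exists_C_sub_sum_sq_mem {n : ℕ}
    {T : Subsemiring (MvPolynomial (Fin n) ℝ)} (hsq : ∀ a, a * a ∈ T)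
    {ψ : MvPolynomial (Fin n) ℝ} (hψ : ψ ∈ T) {N : ℝ} (hN : 0 ≤ N)
    (hbdd : ∀ y, 0 ≤ eval y ψ → ∑ i, y i ^ 2 < N) :
    ∃ r : ℝ, C r - ∑ i, X i ^ 2 ∈ T := by
  set R : MvPolynomial (Fin n) ℝ := ∑ i, X i ^ 2 with hR
  have hRT : R ∈ T := T.sum_mem fun i _ => by rw [sq]; exact hsq _
  have hC : ∀ r : ℝ, 0 ≤ r → (C r : MvPolynomial (Fin n) ℝ) ∈ T := fun r hr =>
    (IsQuadraticModule.of_subsemiring hsq).C_mem hr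
  obtain ⟨t₂, h2, t₁, h1, e⟩ : (-1 : MvPolynomial (Fin n) ℝ) ∈ T.extendBy hsq (R - C N) := by
    classical
    refine neg_one_mem_of_forall_exists_eval_neg (S := {ψ, R - C N})
      (fun a => T.le_extendBy hsq _ (hsq a)) ?_ fun y => ?_
    · simp only [Finset.mem_insert, Finset.mem_singleton, forall_eq_or_imp, forall_eq]
      exact ⟨T.le_extendBy hsq _ hψ, T.mem_extendBy hsq _⟩
    · by_cases hy : 0 ≤ eval y ψ
      · exact ⟨R - C N, by simp, by simpa [hR] using hbdd y hy⟩
      · exact ⟨ψ, by simp, not_le.1 hy⟩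
  have hsq1 : ∀ a, a * a ∈ T.extendBy hsq (C N - R) := fun a => T.le_extendBy hsq _ (hsq a)
  obtain ⟨N', hN', ⟨u, hu, v, hv, e'⟩, -⟩ :=
    (IsQuadraticModule.of_subsemiring hsq1).exists_C_sub_mem (T.mem_extendBy hsq _) t₂
  have hhalf : (C (N' / 2) : MvPolynomial (Fin n) ℝ) * 2 = C N' := by
    rw [show (2 : MvPolynomial (Fin n) ℝ) = C 2 from (map_ofNat C 2).symm, ← C_mul]
    congr 1; ring
  have h3 : C N' + C (N' / 2) * C (N' / 2) - t₂ ∈ T := by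
    convert T.add_mem (T.add_mem (T.mul_mem (T.add_mem T.one_mem h2) hu)
      (T.mul_mem (T.mul_mem hv h1) (hsq (C N - R)))) (hsq (t₂ - C (N' / 2))) using 1
    linear_combination (1 + t₂) * e' - v * (C N - R) * e + t₂ * hhalf
  refine ⟨N + N * (N' + N' / 2 * (N' / 2)), ?_⟩
  convert T.add_mem (T.add_mem (T.mul_mem h1 (hsq (C N - R))) (T.mul_mem h2 hRT))
    (T.mul_mem (hC N hN) h3) using 1
  simp only [C_add, C_mul]
  linear_combination (R - C N) * e

namespace IsQuadraticModule

section CommRing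

variable {A : Type*} [CommRing A] {M : AddSubmonoid A}

theorem exists_maximal (hM : IsQuadraticModule M) (h : -1 ∉ M) :
    ∃ M', M ≤ M' ∧ Maximal (fun M' => IsQuadraticModule M' ∧ -1 ∉ M') M' := by
  have hchain : ∀ c ⊆ {M : AddSubmonoid A | IsQuadraticModule M ∧ -1 ∉ M}, IsChain (· ≤ ·) c →
      ∀ y ∈ c, ∃ ub ∈ {M : AddSubmonoid A | IsQuadraticModule M ∧ -1 ∉ M}, ∀ z ∈ c, z ≤ ub := by
    intro c hc hchain y hy
    have hmem : ∀ x, x ∈ sSup c ↔ ∃ s ∈ c, x ∈ s := fun x =>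
      AddSubmonoid.mem_sSup_of_directedOn ⟨y, hy⟩ hchain.directedOn
    refine ⟨sSup c, ⟨⟨le_sSup hy (hc hy).1.one_mem, fun a x hx => ?_⟩, fun hneg => ?_⟩,
      fun z hz => le_sSup hz⟩
    · obtain ⟨s, hs, hxs⟩ := (hmem x).1 hx
      exact (hmem _).2 ⟨s, hs, (hc hs).1.mul_self_mul_mem a x hxs⟩
    · obtain ⟨s, hs, hneg⟩ := (hmem _).1 hneg
      exact (hc hs).2 hneg
  exact zorn_le_nonempty₀ _ hchain M ⟨hM, h⟩

/-- The quadratic module obtained from a quadratic module by adjoining an element. -/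
theorem exists_adjoin (hM : IsQuadraticModule M) (a : A) :
    ∃ N : AddSubmonoid A, IsQuadraticModule N ∧ M ≤ N ∧ a ∈ N ∧
      ∀ x, x ∈ N ↔ ∃ m ∈ M, ∃ σ, IsSumSq σ ∧ x = m + σ * a := by
  let N : AddSubmonoid A :=
    { carrier := {x | ∃ m ∈ M, ∃ σ, IsSumSq σ ∧ x = m + σ * a}
      zero_mem' := ⟨0, M.zero_mem, 0, .zero, by ring⟩
      add_mem' := by
        rintro _ _ ⟨m, hm, σ, hσ, rfl⟩ ⟨m', hm', σ', hσ', rfl⟩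
        exact ⟨m + m', M.add_mem hm hm', σ + σ', hσ.add hσ', by ring⟩ }
  refine ⟨N, ⟨⟨1, hM.one_mem, 0, .zero, by ring⟩, ?_⟩, fun x hx => ⟨x, hx, 0, .zero, by ring⟩,
    ⟨0, M.zero_mem, 1, IsSumSq.one, by ring⟩, fun x => Iff.rfl⟩
  rintro b _ ⟨m, hm, σ, hσ, rfl⟩
  exact ⟨b * b * m, hM.mul_self_mul_mem b m hm, b * b * σ, (IsSumSq.mul_self b).mul hσ, by ring⟩

end CommRing

section MvPolynomial

variable {n : ℕ} {M : AddSubmonoid (MvPolynomial (Fin n) ℝ)}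

theorem mul_mem_of_mem_of_neg_mem (hM : IsQuadraticModule M) {a : MvPolynomial (Fin n) ℝ}
    (ha : a ∈ M) (ha' : -a ∈ M) (c : MvPolynomial (Fin n) ℝ) : c * a ∈ M := by
  refine hM.mem_of_C_mul_mem (r := 4) (by norm_num) ?_
  convert M.add_mem (hM.mul_self_mul_mem (c + 1) _ ha) (hM.mul_self_mul_mem (c - 1) _ ha') using 1
  rw [map_ofNat C 4]
  ring

theorem mem_or_neg_mem_of_maximal
    (hM : Maximal (fun M : AddSubmonoid (MvPolynomial (Fin n) ℝ) =>
      IsQuadraticModule M ∧ -1 ∉ M) M) (a : MvPolynomial (Fin n) ℝ) : a ∈ M ∨ -a ∈ M := by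
  have key : ∀ a ∉ M, ∃ m ∈ M, ∃ σ, IsSumSq σ ∧ -1 = m + σ * a := by
    intro a ha
    obtain ⟨N, hN, hMN, haN, hmem⟩ := hM.1.1.exists_adjoin a
    by_contra hcon
    exact ha (hM.2 ⟨hN, fun h => hcon ((hmem _).1 h)⟩ hMN haN)
  by_contra! h
  obtain ⟨s, hs, σ, hσ, h1⟩ := key _ h.1
  obtain ⟨t, ht, τ, hτ, h2⟩ := key _ h.2
  have h3 : -σ ∈ M := by
    rw [show -σ = τ + τ * s + σ * t by linear_combination τ * h1 + σ * h2]
    exact M.add_mem (M.add_mem (hM.1.1.isSumSq_mem hτ) (hM.1.1.isSumSq_mul_mem hτ hs))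
      (hM.1.1.isSumSq_mul_mem hσ ht)
  refine hM.1.2 ?_
  rw [h1, mul_comm]
  exact M.add_mem hs (hM.1.1.mul_mem_of_mem_of_neg_mem (hM.1.1.isSumSq_mem hσ) h3 a)

/-- A proper Archimedean quadratic module of the real polynomial ring is nonnegative at some
real point. -/
theorem exists_eval_nonneg (hM : IsQuadraticModule M) {N : ℝ} (hN : C N - ∑ i, X i ^ 2 ∈ M)
    (h : -1 ∉ M) : ∃ y, ∀ q ∈ M, 0 ≤ eval y q := by
  obtain ⟨M', hle, hmax⟩ := hM.exists_maximal h
  suffices ∃ y, ∀ q ∈ M', 0 ≤ eval y q from this.imp fun y hy q hq => hy q (hle hq)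
  replace hN := hle hN
  clear h hM hle
  have hM := hmax.1.1
  have hC : ∀ r : ℝ, C r ∈ M' → 0 ≤ r := by
    intro r hr
    by_contra! hneg
    refine hmax.1.2 (hM.mem_of_C_mul_mem (r := -r) (by linarith) ?_)
    simpa using hr
  have hor := mem_or_neg_mem_of_maximal hmax
  let J : MvPolynomial (Fin n) ℝ → Prop := fun a => ∀ ε : ℝ, 0 < ε → C ε - a ∈ M' ∧ C ε + a ∈ M'
  have hJadd : ∀ a b, J a → J b → J (a + b) := by
    intro a b ha hb ε hε
    obtain ⟨h1, h2⟩ := ha (ε / 2) (by positivity)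
    obtain ⟨h3, h4⟩ := hb (ε / 2) (by positivity)
    have e : (C ε : MvPolynomial (Fin n) ℝ) = C (ε / 2) + C (ε / 2) := by
      rw [← C_add]; congr 1; ring
    constructor
    · convert M'.add_mem h1 h3 using 1
      rw [e]; ring
    · convert M'.add_mem h2 h4 using 1
      rw [e]; ring
  have hJneg : ∀ a, J a → J (-a) := fun a ha ε hε =>
    ⟨by simpa using (ha ε hε).2, by simpa [sub_eq_add_neg] using (ha ε hε).1⟩
  have hJsq : ∀ c a, J a → J (c * c * a) := by
    intro c a ha ε hε
    obtain ⟨r, hr, h1, -⟩ := hM.exists_C_sub_mem hN (c * c)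
    obtain ⟨h2, h3⟩ := ha (ε / r) (by positivity)
    have h4 := hM.C_mul_mem (r := ε / r) (by positivity) h1
    have e : (C (ε / r) * C r : MvPolynomial (Fin n) ℝ) = C ε := by
      rw [← C_mul, div_mul_cancel₀ _ hr.ne']
    constructor
    · convert M'.add_mem (hM.mul_self_mul_mem c _ h2) h4 using 1
      linear_combination -e
    · convert M'.add_mem (hM.mul_self_mul_mem c _ h3) h4 using 1
      linear_combination -e
  have hJmul : ∀ c a, J a → J (c * a) := by
    intro c a ha ε hε
    obtain ⟨h1, h2⟩ := hJadd _ _ (hJsq (c + 1) a ha) (hJneg _ (hJsq (c - 1) a ha)) (4 * ε)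
      (by positivity)
    constructor
    · refine hM.mem_of_C_mul_mem (r := 4) (by norm_num) ?_
      convert h1 using 1
      rw [C_mul, map_ofNat C 4]; ring
    · refine hM.mem_of_C_mul_mem (r := 4) (by norm_num) ?_
      convert h2 using 1
      rw [C_mul, map_ofNat C 4]; ring
  have hJst : ∀ a, ∃ r : ℝ, J (a - C r) := by
    intro a
    obtain ⟨r₀, hr₀, h1, h2⟩ := hM.exists_C_sub_mem hN a
    let R : Set ℝ := {r | a - C r ∈ M'}
    have hne : R.Nonempty := ⟨-r₀, by
      change a - C (-r₀) ∈ M'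
      rwa [C_neg, sub_neg_eq_add, add_comm]⟩
    have hbdd : BddAbove R := ⟨r₀, fun r hr => by
      have := M'.add_mem h1 hr
      rw [show C r₀ - a + (a - C r) = C (r₀ - r) by rw [C_sub]; ring] at this
      linarith [hC _ this]⟩
    refine ⟨sSup R, fun ε hε => ⟨?_, ?_⟩⟩
    · have h3 : sSup R + ε ∉ R := fun h => by linarith [le_csSup hbdd h]
      convert (hor (a - C (sSup R + ε))).resolve_left h3 using 1
      rw [C_add]; ring
    · obtain ⟨r, hr, hlt⟩ := exists_lt_of_lt_csSup hne (show sSup R - ε < sSup R by linarith)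
      convert M'.add_mem hr (hM.C_mem (r := r - sSup R + ε) (by linarith)) using 1
      rw [C_add, C_sub]; ring
  choose y hy using fun i => hJst (X i)
  have hJeval : ∀ p, J (p - C (eval y p)) := by
    intro p
    induction p using MvPolynomial.induction_on with
    | C a =>
      intro ε hε
      simpa using hM.C_mem hε.le
    | add p q hp hq =>
      convert hJadd _ _ hp hq using 1
      rw [map_add, C_add]; ring
    | mul_X p i hp =>
      convert hJadd _ _ (hJmul (X i) _ hp) (hJmul (C (eval y p)) _ (hy i)) using 1
      rw [map_mul, eval_X, C_mul]; ring
  refine ⟨y, fun q hq => ?_⟩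
  by_contra! hneg
  have h1 := M'.add_mem hq (hJeval q (-eval y q / 2) (by linarith)).1
  rw [show q + (C (-eval y q / 2) - (q - C (eval y q))) = C (-eval y q / 2 + eval y q) by
    rw [C_add]; ring] at h1
  linarith [hC _ h1]

/-- **Putinar's Positivstellensatz** -/
theorem mem_of_forall_eval_pos (hM : IsQuadraticModule M) {N : ℝ}
    (hN : C N - ∑ i, X i ^ 2 ∈ M) {p : MvPolynomial (Fin n) ℝ}
    (hp : ∀ y, (∀ q ∈ M, 0 ≤ eval y q) → 0 < eval y p) : p ∈ M := by
  obtain ⟨M', hM', hle, hpM', hmem⟩ := hM.exists_adjoin (-p)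
  have hneg : -1 ∈ M' := by
    by_contra h
    obtain ⟨y, hy⟩ := hM'.exists_eval_nonneg (hle hN) h
    have h1 := hp y fun q hq => hy q (hle hq)
    have h2 := hy _ hpM'
    rw [map_neg] at h2
    linarith
  obtain ⟨q, hq, σ, hσ, e⟩ := (hmem _).1 hneg
  obtain ⟨r₁, hr₁, h1, -⟩ := hM.exists_C_sub_mem hN σ
  obtain ⟨r₂, hr₂, h2, -⟩ := hM.exists_C_sub_mem hN (1 + σ ^ 2 * p)
  obtain ⟨r₀, hr₀, -, h0⟩ := hM.exists_C_sub_mem hN p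
  set k : ℝ := (r₁ + r₂) / 2 with hkdef
  have hk : 0 < k := by positivity
  have h2k : (C (2 * k) : MvPolynomial (Fin n) ℝ) = 2 * C k := by
    rw [C_mul, map_ofNat C 2]
  have h3 : 2 * C k - σ ∈ M := by
    convert M.add_mem h1 (hM.C_mem hr₂.le) using 1
    rw [← h2k, show 2 * k = r₁ + r₂ by rw [hkdef]; ring, C_add]
    ring
  have h4 : 2 * C k - (1 + σ ^ 2 * p) ∈ M := by
    convert M.add_mem h2 (hM.C_mem hr₁.le) using 1
    rw [← h2k, show 2 * k = r₁ + r₂ by rw [hkdef]; ring, C_add]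
    ring
  have hstep : ∀ r : ℝ, 0 ≤ r → C r + p ∈ M → C (r - (k ^ 2)⁻¹) + p ∈ M := by
    intro r hr hrp
    refine hM.mem_of_C_mul_mem (r := k ^ 2) (by positivity) ?_
    convert M.add_mem (M.add_mem (M.add_mem (hM.mul_self_mul_mem (C k - σ) _ hrp)
      (hM.C_mul_mem (r := 2 * k) (by positivity) hq))
      (hM.C_mul_mem hr (hM.isSumSq_mul_mem hσ h3))) h4 using 1
    have e1 : (C (k ^ 2) * C (r - (k ^ 2)⁻¹) : MvPolynomial (Fin n) ℝ) = C k ^ 2 * C r - 1 := by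
      rw [← C_mul, mul_sub, mul_inv_cancel₀ (by positivity), C_sub, C_mul, C_pow, C_1]
    rw [h2k, mul_add, e1, C_pow]
    linear_combination 2 * C k * e
  by_contra hpM
  have hall : ∀ j : ℕ, 0 ≤ r₀ - j * (k ^ 2)⁻¹ ∧ C (r₀ - j * (k ^ 2)⁻¹) + p ∈ M := by
    intro j
    induction j with
    | zero => simpa using ⟨hr₀.le, h0⟩
    | succ j ih =>
      have h5 := hstep _ ih.1 ih.2
      rw [show r₀ - j * (k ^ 2)⁻¹ - (k ^ 2)⁻¹ = r₀ - (j + 1 : ℕ) * (k ^ 2)⁻¹ by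
        push_cast; ring] at h5
      refine ⟨?_, h5⟩
      by_contra! hlt
      refine hpM ?_
      convert M.add_mem h5 (hM.C_mem (r := -(r₀ - (j + 1 : ℕ) * (k ^ 2)⁻¹)) (by linarith)) using 1
      rw [C_neg]; ring
  obtain ⟨j, hj⟩ := exists_nat_gt (r₀ * k ^ 2)
  have h5 := (hall j).1
  rw [sub_nonneg, ← div_eq_mul_inv, div_le_iff₀ (by positivity)] at h5
  linarith

end MvPolynomial

end IsQuadraticModule

theorem sosPoly_iff_isSumSq {n : ℕ} {p : MvPolynomial (Fin n) ℝ} : SOSPoly p ↔ IsSumSq p := by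
  constructor
  · rintro ⟨t, q, rfl⟩
    exact IsSumSq.sum fun i _ => by rw [sq]; exact IsSumSq.mul_self _
  · intro h
    induction h with
    | zero => exact ⟨0, Fin.elim0, by simp⟩
    | sq_add a _ ih =>
      obtain ⟨t, q, rfl⟩ := ih
      exact ⟨t + 1, Fin.cons a q, by simp [Fin.sum_univ_succ, sq]⟩

theorem eval_nonneg_of_sosPoly {n : ℕ} {p : MvPolynomial (Fin n) ℝ} (hp : SOSPoly p)
    (y : Fin n → ℝ) : 0 ≤ eval y p := by
  obtain ⟨t, q, rfl⟩ := hp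
  rw [map_sum]
  exact Finset.sum_nonneg fun i _ => by rw [map_pow]; positivity

section QuadraticModule

variable {n m s : ℕ} {g : Fin s → MvPolynomial (Fin n) ℝ}

theorem exists_addSubmonoid_iff_qModMem (g : Fin s → MvPolynomial (Fin n) ℝ) :
    ∃ M : AddSubmonoid (MvPolynomial (Fin n) ℝ),
      IsQuadraticModule M ∧ ∀ p, p ∈ M ↔ QModMem g p := by
  let M : AddSubmonoid (MvPolynomial (Fin n) ℝ) :=
    { carrier := {p | QModMem g p}
      zero_mem' := ⟨0, 0, sosPoly_iff_isSumSq.2 .zero, fun _ => sosPoly_iff_isSumSq.2 .zero,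
        by simp⟩
      add_mem' := by
        rintro _ _ ⟨σ₀, σ, h0, h, rfl⟩ ⟨τ₀, τ, h0', h', rfl⟩
        simp only [sosPoly_iff_isSumSq] at *
        refine ⟨σ₀ + τ₀, σ + τ, sosPoly_iff_isSumSq.2 (h0.add h0'),
          fun j => sosPoly_iff_isSumSq.2 ((h j).add (h' j)), ?_⟩
        simp only [Pi.add_apply, add_mul, Finset.sum_add_distrib]
        ring }
  refine ⟨M, ⟨⟨1, 0, sosPoly_iff_isSumSq.2 .one, fun _ => sosPoly_iff_isSumSq.2 .zero,
    by simp⟩, ?_⟩, fun p => Iff.rfl⟩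
  rintro a _ ⟨σ₀, σ, h0, h, rfl⟩
  simp only [sosPoly_iff_isSumSq] at *
  refine ⟨a * a * σ₀, fun j => a * a * σ j,
    sosPoly_iff_isSumSq.2 ((IsSumSq.mul_self a).mul h0),
    fun j => sosPoly_iff_isSumSq.2 ((IsSumSq.mul_self a).mul (h j)), ?_⟩
  rw [mul_add, Finset.mul_sum]
  simp only [mul_assoc]

theorem QMArchimedean.exists_qModMem_sub_sum_sq (h : QMArchimedean g) :
    ∃ N : ℝ, QModMem g (C N - ∑ i, X i ^ 2) := by
  obtain ⟨ψ, hψ, hcomp⟩ := h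
  obtain ⟨M, hM, hmem⟩ := exists_addSubmonoid_iff_qModMem g
  have hcont : Continuous fun y : Fin n → ℝ => ∑ i, y i ^ 2 := by fun_prop
  obtain ⟨B, hB⟩ := (hcomp.image hcont).bddAbove
  have hsq : ∀ a : MvPolynomial (Fin n) ℝ, a * a ∈ Subsemiring.sumSq (MvPolynomial (Fin n) ℝ) :=
    fun a => Subsemiring.mem_sumSq.2 (IsSumSq.mul_self a)
  obtain ⟨r, s, hs, t, ht, e⟩ := Subsemiring.exists_C_sub_sum_sq_mem
    (T := (Subsemiring.sumSq _).extendBy hsq ψ) (fun a => Subsemiring.le_extendBy _ hsq _ (hsq a))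
    (Subsemiring.mem_extendBy _ hsq ψ) (N := |B| + 1) (by positivity) fun y hy => by
      have := hB ⟨y, hy, rfl⟩
      simp only at this
      linarith [le_abs_self B]
  refine ⟨r, ?_⟩
  rw [← hmem, e]
  exact M.add_mem (hM.isSumSq_mem (Subsemiring.mem_sumSq.1 hs))
    (hM.isSumSq_mul_mem (Subsemiring.mem_sumSq.1 ht) ((hmem _).2 hψ))

theorem QMArchimedean.qModMem_of_pos (h : QMArchimedean g) {p : MvPolynomial (Fin n) ℝ}
    (hp : ∀ y ∈ indexSet g, 0 < eval y p) : QModMem g p := by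
  obtain ⟨N, hN⟩ := h.exists_qModMem_sub_sum_sq
  obtain ⟨M, hM, hmem⟩ := exists_addSubmonoid_iff_qModMem g
  rw [← hmem] at hN ⊢
  refine hM.mem_of_forall_eval_pos hN fun y hy => hp y fun j => hy _ ?_
  rw [hmem]
  refine ⟨0, Pi.single j 1, sosPoly_iff_isSumSq.2 .zero, fun i => ?_, ?_⟩
  · rw [sosPoly_iff_isSumSq]
    by_cases hi : i = j
    · subst hi; simp
    · simp [hi]
  · simp [Pi.single_apply]

theorem QModMemK.mono {k₁ k₂ : ℕ} (hk : k₁ ≤ k₂) {p : MvPolynomial (Fin n) ℝ}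
    (h : QModMemK g k₁ p) : QModMemK g k₂ p := by
  obtain ⟨σ₀, σ, h0, h, hd0, hd, e⟩ := h
  exact ⟨σ₀, σ, h0, h, by omega, fun j => (hd j).trans (by omega), e⟩

theorem QModMem.exists_qModMemK {p : MvPolynomial (Fin n) ℝ} (h : QModMem g p) :
    ∃ k, QModMemK g k p := by
  obtain ⟨σ₀, σ, h0, h, e⟩ := h
  refine ⟨σ₀.totalDegree + ∑ j, (σ j * g j).totalDegree, σ₀, σ, h0, h, by omega, fun j => ?_, e⟩
  have : (σ j * g j).totalDegree ≤ ∑ j, (σ j * g j).totalDegree :=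
    Finset.single_le_sum (f := fun j => (σ j * g j).totalDegree)
      (fun i _ => Nat.zero_le _) (Finset.mem_univ j)
  omega

theorem QModMemK.eval_nonneg {k : ℕ} {p : MvPolynomial (Fin n) ℝ} (h : QModMemK g k p)
    {y : Fin n → ℝ} (hy : y ∈ indexSet g) : 0 ≤ eval y p := by
  obtain ⟨σ₀, σ, h0, h, -, -, rfl⟩ := h
  rw [map_add, map_sum]
  refine add_nonneg (eval_nonneg_of_sosPoly h0 y) (Finset.sum_nonneg fun j _ => ?_)
  rw [map_mul]
  exact mul_nonneg (eval_nonneg_of_sosPoly (h j) y) (hy j)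

theorem psosK_antitone (c : Fin m → ℝ) (a : Fin m → MvPolynomial (Fin n) ℝ)
    (b : MvPolynomial (Fin n) ℝ) (g : Fin s → MvPolynomial (Fin n) ℝ) :
    Antitone (psosK c a b g) := fun _ _ hk =>
  sInf_le_sInf (Set.image_mono fun _ hx => QModMemK.mono hk hx)

theorem eval_sum_C_mul_add (a : Fin m → MvPolynomial (Fin n) ℝ) (b : MvPolynomial (Fin n) ℝ)
    (x : Fin m → ℝ) (y : Fin n → ℝ) :
    eval y ((∑ i, C (x i) * a i) + b) = (∑ i, x i * eval y (a i)) + eval y b := by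
  simp

theorem exists_psosK_lt (c : Fin m → ℝ) {a : Fin m → MvPolynomial (Fin n) ℝ}
    {b : MvPolynomial (Fin n) ℝ} (harch : QMArchimedean g) {x x' : Fin m → ℝ}
    (hx : isFeasible a b g x)
    (hx' : ∀ y ∈ indexSet g, 0 < (∑ i, x' i * eval y (a i)) + eval y b)
    {v : ℝ} (hv : ∑ i, c i * x i < v) : ∃ k, psosK c a b g k < v := by
  have hlim : Filter.Tendsto (fun t : ℝ => ∑ i, c i * ((1 - t) * x i + t * x' i))
      (nhdsWithin 0 (Set.Ioi 0)) (nhds (∑ i, c i * x i)) := by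
    have hcont : Continuous fun t : ℝ => ∑ i, c i * ((1 - t) * x i + t * x' i) := by fun_prop
    simpa using (hcont.tendsto 0).mono_left nhdsWithin_le_nhds
  have h01 : ∀ᶠ t : ℝ in nhdsWithin 0 (Set.Ioi 0), t ∈ Set.Ioo (0 : ℝ) 1 :=
    Ioo_mem_nhdsGT one_pos
  obtain ⟨t, htv, ht0, ht1⟩ := ((hlim.eventually_lt_const hv).and h01).exists
  have hmem : QModMem g ((∑ i, C ((1 - t) * x i + t * x' i) * a i) + b) := by
    refine harch.qModMem_of_pos fun y hy => ?_
    have h1 := mul_nonneg (sub_nonneg.2 ht1.le) (hx y hy)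
    have h2 := mul_pos ht0 (hx' y hy)
    rw [eval_sum_C_mul_add]
    have e : ∑ i, ((1 - t) * x i + t * x' i) * eval y (a i)
        = (1 - t) * ∑ i, x i * eval y (a i) + t * ∑ i, x' i * eval y (a i) := by
      simp only [Finset.mul_sum, ← Finset.sum_add_distrib]
      exact Finset.sum_congr rfl fun i _ => by ring
    rw [e]
    linarith
  obtain ⟨k, hk⟩ := hmem.exists_qModMemK
  have hle : psosK c a b g k ≤ ((∑ i, c i * ((1 - t) * x i + t * x' i) : ℝ) : EReal) :=
    sInf_le ⟨fun i => (1 - t) * x i + t * x' i, hk, rfl⟩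
  exact ⟨k, hle.trans_lt (EReal.coe_lt_coe_iff.2 htv)⟩

end QuadraticModule

/-- under the Archimedean and Slater conditions, the values p^sos_k,
k ≥ d_P, are nonincreasing in k, bounded below by p*, and converge to p*. -/
theorem stmt2 {n m s : ℕ} (c : Fin m → ℝ) (a : Fin m → MvPolynomial (Fin n) ℝ)
    (b : MvPolynomial (Fin n) ℝ) (g : Fin s → MvPolynomial (Fin n) ℝ)
    (pstar : ℝ)
    (hfeas : ∃ x, isFeasible a b g x)
    (hglb : IsGLB {v : ℝ | ∃ x, isFeasible a b g x ∧ v = ∑ i, c i * x i} pstar)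
    (harch : QMArchimedean g)
    (hslater : ∃ x : Fin m → ℝ, ∀ y ∈ indexSet g,
      0 < (∑ i, x i * eval y (a i)) + eval y b) :
    (∀ k₁ k₂ : ℕ, dP a b g ≤ k₁ → k₁ ≤ k₂ → psosK c a b g k₂ ≤ psosK c a b g k₁) ∧
    (∀ k : ℕ, dP a b g ≤ k → (pstar : EReal) ≤ psosK c a b g k) ∧
    Filter.Tendsto (psosK c a b g) Filter.atTop (nhds (pstar : EReal)) := by
  have hlow : ∀ k, (pstar : EReal) ≤ psosK c a b g k := by
    intro k
    refine le_sInf ?_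
    rintro _ ⟨x, hx, rfl⟩
    have hfx : isFeasible a b g x := fun y hy => by
      rw [← eval_sum_C_mul_add]
      exact QModMemK.eval_nonneg hx hy
    exact EReal.coe_le_coe_iff.2 (hglb.1 ⟨x, hfx, rfl⟩)
  have hanti := psosK_antitone c a b g
  refine ⟨fun k₁ k₂ _ hk => hanti hk, fun k _ => hlow k, ?_⟩
  obtain ⟨x', hx'⟩ := hslater
  refine tendsto_order.2 ⟨fun v hv => .of_forall fun k => hv.trans_le (hlow k), fun v hv => ?_⟩
  obtain ⟨w, hw, hwv⟩ := EReal.lt_iff_exists_real_btwn.1 hv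
  obtain ⟨_, ⟨x, hx, rfl⟩, -, hlt⟩ := hglb.exists_between (EReal.coe_lt_coe_iff.1 hw)
  obtain ⟨k, hk⟩ := exists_psosK_lt c harch hx hx' hlt
  filter_upwards [Filter.eventually_ge_atTop k] with l hl
  exact (hanti hl).trans_lt (hk.trans hwv)
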